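/- (Stable determination of convex lattice sets) For every d ≥ 2 there exist sets 𝒮 of four lattice lines in ℝ^d with the following property: if F₁, F₂ ⊆ ℤ^d are finite convex lattice sets with |F₁| = |F₂| and F₁ ≠ F₂, then Δ_𝒮(F₁, F₂) ≥ 6. Moreover, for every set 𝒮 of at least seven pairwise distinct lattice lines contained in a common 2-dimensional linear subspace, and finite convex lattice sets F₁ ≠ F₂ with |F₁| = |F₂|, one has Δ_𝒮(F₁, F₂) ≥ 2(|𝒮| − 1). -/

import Mathlib

open Set

variable {d : ℕ}

/-- The affine line through the coset `T` of the modulo-`S` quotient, i.e. an affine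
line parallel to `S` when `S` is 1-dimensional. -/
def fiber (S : Submodule ℝ (Fin d → ℝ)) (T : (Fin d → ℝ) ⧸ S) : Set (Fin d → ℝ) :=
  {x | (Submodule.Quotient.mk x : (Fin d → ℝ) ⧸ S) = T}

/-- `F₁` and `F₂` have the same (discrete) X-ray parallel to `S`. -/
def XrayEq (S : Submodule ℝ (Fin d → ℝ)) (F₁ F₂ : Set (Fin d → ℝ)) : Prop :=
  ∀ T : (Fin d → ℝ) ⧸ S, (F₁ ∩ fiber S T).ncard = (F₂ ∩ fiber S T).ncard

/-- `F₁` and `F₂` are tomographically equivalent w.r.t. the family `𝒮` of lines. -/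
def TomEq (𝒮 : Set (Submodule ℝ (Fin d → ℝ))) (F₁ F₂ : Set (Fin d → ℝ)) : Prop :=
  ∀ S ∈ 𝒮, XrayEq S F₁ F₂

/-- A lattice line: a line through the origin spanned by a nonzero integer vector. -/
def IsLatticeLine (S : Submodule ℝ (Fin d → ℝ)) : Prop :=
  ∃ v : Fin d → ℤ, v ≠ 0 ∧ S = Submodule.span ℝ {fun i => (v i : ℝ)}

/-- The canonical embedding of `ℤ^d` into `ℝ^d`. -/
def embed (x : Fin d → ℤ) : Fin d → ℝ := fun i => (x i : ℝ)

/-- The X-ray difference `Δ_𝒮(F₁,F₂)`. -/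
noncomputable def xrayDiff (𝒮 : Set (Submodule ℝ (Fin d → ℝ))) (F₁ F₂ : Set (Fin d → ℝ)) : ℕ :=
  ∑ᶠ S ∈ 𝒮, ∑ᶠ T : (Fin d → ℝ) ⧸ S,
    (((F₁ ∩ fiber S T).ncard : ℤ) - ((F₂ ∩ fiber S T).ncard : ℤ)).natAbs

/-- A convex lattice set: `F = conv(F) ∩ ℤ^d`. -/
def IsConvexLatticeSet (F : Finset (Fin d → ℤ)) : Prop :=
  embed '' ↑F = convexHull ℝ (embed '' ↑F) ∩ Set.range (embed : (Fin d → ℤ) → (Fin d → ℝ))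


section PartNt
lemma abs_eq_one_of_padic (r : ℚ) (h0 : r ≠ 0) (h : ∀ p : ℕ, p.Prime → padicValRat p r = 0) : |r| = 1 := by
  have hn : r.num.natAbs = 1 := by
    by_contra hne
    obtain ⟨p, hp, hd⟩ := Nat.exists_prime_and_dvd hne
    have := Fact.mk hp
    have h1 := h p hp
    have hcop : ¬ p ∣ r.den := fun hd2 => by
      have := Nat.dvd_gcd hd hd2
      rw [Nat.Coprime.gcd_eq_one r.reduced] at this
      exact hp.one_lt.ne' (Nat.dvd_one.mp this)
    have h3 : padicValNat p r.den = 0 := padicValNat.eq_zero_of_not_dvd hcop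
    have h4 : 1 ≤ padicValNat p r.num.natAbs :=
      one_le_padicValNat_of_dvd (by simpa using h0) hd
    simp only [padicValRat, padicValInt, h3] at h1
    omega
  have hd : r.den = 1 := by
    by_contra hne
    obtain ⟨p, hp, hd⟩ := Nat.exists_prime_and_dvd hne
    have := Fact.mk hp
    have h1 := h p hp
    have h4 : 1 ≤ padicValNat p r.den :=
      one_le_padicValNat_of_dvd r.den_ne_zero hd
    simp only [padicValRat, padicValInt, hn, padicValNat_one_right] at h1
    omega
  have : r = r.num := by
    conv_lhs => rw [← Rat.num_div_den r, hd]
    simp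
  rw [this]
  rcases Int.natAbs_eq r.num with h | h <;> rw [h, hn] <;> simp

def GoodAbs (r : ℚ) : Prop := r = 1 ∨ r = 2 ∨ r = 3 ∨ r = 4 ∨ r = 1/2 ∨ r = 1/3 ∨ r = 1/4 ∨
  r = 3/2 ∨ r = 2/3 ∨ r = 3/4 ∨ r = 4/3

/-- A weight `ρ ^ c` with `ρ = 1` or prime, and `c (ρ - 1) ≤ e`. -/
def GoodW (e : ℕ) (x : ℚ) : Prop := ∃ ρ c : ℕ, x = (ρ : ℚ) ^ c ∧ (ρ = 1 ∨ ρ.Prime) ∧ c * (ρ - 1) ≤ e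

lemma GoodW.val {e : ℕ} {x : ℚ} (h : GoodW e x) : x ≠ 0 ∧ ∃ v : ℕ → ℕ,
    (∀ p : ℕ, p.Prime → padicValRat p x = v p ∧ v p * (p - 1) ≤ e) ∧
    (v 3 ≠ 0 → v 2 = 0) := by
  obtain ⟨ρ, c, rfl, hρ, hc⟩ := h
  rcases hρ with rfl | hρ
  · refine ⟨by simp, fun _ => 0, ?_, ?_⟩ <;> simp
  · refine ⟨by simp [hρ.ne_zero], fun p => if p = ρ then c else 0, ?_, ?_⟩
    · intro p hp
      have := Fact.mk hp
      have := Fact.mk hρ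
      rw [padicValRat.pow]
      rw [padicValRat.of_nat]
      dsimp only
      split_ifs with h
      · subst h; simp [hc]
      · rw [padicValNat_primes h]; simp
    · intro h
      have h3 : 3 = ρ := by
        by_contra h'
        simp [h'] at h
      simp [← h3]

lemma good_of_val {e : ℕ} (he : 0 < e) (r x y z w : ℚ) (hr : 0 < r) (hx : GoodW e x) (hy : GoodW e y)
    (hz : GoodW e z) (hw : GoodW e w) (h : r ^ e * (z * w) = x * y) : GoodAbs r := by
  obtain ⟨x0, vx, hvx, hx3⟩ := hx.val
  obtain ⟨y0, vy, hvy, hy3⟩ := hy.val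
  obtain ⟨z0, vz, hvz, hz3⟩ := hz.val
  obtain ⟨w0, vw, hvw, hw3⟩ := hw.val
  have key : ∀ p : ℕ, p.Prime → (e : ℤ) * padicValRat p r = vx p + vy p - vz p - vw p := by
    intro p hp
    have := Fact.mk hp
    have := congrArg (padicValRat p) h
    rw [padicValRat.mul (pow_ne_zero _ hr.ne') (mul_ne_zero z0 w0), padicValRat.mul z0 w0,
      padicValRat.mul x0 y0, padicValRat.pow, (hvx p hp).1, (hvy p hp).1, (hvz p hp).1,
      (hvw p hp).1] at this
    linarith
  have e0 : (0 : ℤ) < e := by exact_mod_cast he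
  have big : ∀ p : ℕ, p.Prime → 5 ≤ p → padicValRat p r = 0 := by
    intro p hp h5
    have := key p hp
    have b : ∀ v : ℕ, v * (p - 1) ≤ e → 4 * v ≤ e := fun v hv => by
      have : 4 ≤ p - 1 := by omega
      nlinarith
    have bx := b _ (hvx p hp).2
    have bY := b _ (hvy p hp).2
    have bz := b _ (hvz p hp).2
    have bw := b _ (hvw p hp).2
    by_contra hne
    rcases lt_or_gt_of_ne hne with h' | h'
    · have : (e : ℤ) * padicValRat p r ≤ e * (-1) := by gcongr; omega
      omega
    · have : (e : ℤ) * 1 ≤ e * padicValRat p r := by gcongr; omega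
      omega
  set a := padicValRat 2 r with ha
  set b := padicValRat 3 r with hb
  have k2 := key 2 Nat.prime_two
  have k3 := key 3 Nat.prime_three
  have x2 := (hvx 2 Nat.prime_two).2
  have y2 := (hvy 2 Nat.prime_two).2
  have z2 := (hvz 2 Nat.prime_two).2
  have w2 := (hvw 2 Nat.prime_two).2
  have x3 := (hvx 3 Nat.prime_three).2
  have y3 := (hvy 3 Nat.prime_three).2
  have z3 := (hvz 3 Nat.prime_three).2
  have w3 := (hvw 3 Nat.prime_three).2
  rw [← ha] at k2
  rw [← hb] at k3
  have a1 : a ≤ 2 := by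
    by_contra hh
    have : (e : ℤ) * 3 ≤ e * a := by gcongr; omega
    omega
  have a2 : -2 ≤ a := by
    by_contra hh
    have : (e : ℤ) * a ≤ e * (-3) := by gcongr; omega
    omega
  have b1 : b ≤ 1 := by
    by_contra hh
    have : (e : ℤ) * 2 ≤ e * b := by gcongr; omega
    omega
  have b2 : -1 ≤ b := by
    by_contra hh
    have : (e : ℤ) * b ≤ e * (-2) := by gcongr; omega
    omega
  have hrab : r = 2 ^ a * 3 ^ b := by
    have hpos : (0:ℚ) < 2 ^ a * 3 ^ b := by positivity
    have h1 : |r / (2 ^ a * 3 ^ b)| = 1 := by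
      apply abs_eq_one_of_padic _ (div_ne_zero hr.ne' hpos.ne')
      intro p hp
      have := Fact.mk hp
      rw [padicValRat.div hr.ne' hpos.ne', padicValRat.mul (by positivity) (by positivity),
        padicValRat.zpow, padicValRat.zpow]
      have e2 : padicValRat p 2 = padicValNat p 2 := by exact_mod_cast padicValRat.of_nat (p := p) (n := 2)
      have e3 : padicValRat p 3 = padicValNat p 3 := by exact_mod_cast padicValRat.of_nat (p := p) (n := 3)
      rw [e2, e3]
      have := Fact.mk Nat.prime_two
      have := Fact.mk Nat.prime_three
      by_cases hp2 : p = 2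
      · subst hp2
        rw [padicValNat_primes (p := 2) (q := 3) (by norm_num)]
        simp [ha]
      by_cases hp3 : p = 3
      · subst hp3
        rw [padicValNat_primes (p := 3) (q := 2) (by norm_num)]
        simp [hb]
      rw [padicValNat_primes hp2, padicValNat_primes hp3, big p hp]
      · simp
      · have := hp.two_le
        by_contra hh
        have : p = 4 := by omega
        subst this
        revert hp; norm_num
    rw [abs_of_pos (by positivity), div_eq_one_iff_eq hpos.ne'] at h1
    exact h1
  clear_value a b
  rw [hrab]
  have hb3 : b = -1 ∨ b = 0 ∨ b = 1 := by omega
  have ha3 : a = -2 ∨ a = -1 ∨ a = 0 ∨ a = 1 ∨ a = 2 := by omega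
  have hbp : b = 1 → a ≤ 0 := by
    rintro rfl
    have : vx 3 ≠ 0 := by omega
    have := hx3 this
    have : vy 3 ≠ 0 := by omega
    have := hy3 this
    by_contra hh
    have : (e : ℤ) * 1 ≤ e * a := by gcongr; omega
    omega
  have hbn : b = -1 → 0 ≤ a := by
    rintro rfl
    have : vz 3 ≠ 0 := by omega
    have := hz3 this
    have : vw 3 ≠ 0 := by omega
    have := hw3 this
    by_contra hh
    have : (e : ℤ) * a ≤ e * (-1) := by gcongr; omega
    omega
  clear k2 k3
  unfold GoodAbs
  rcases hb3 with rfl | rfl | rfl <;> rcases ha3 with rfl | rfl | rfl | rfl | rfl <;>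
    first
    | (exfalso; omega)
    | norm_num [zpow_neg]


open Polynomial in
lemma goodW_norm {K : Type*} [Field K] [CharZero K] [Algebra ℚ K] [FiniteDimensional ℚ K] (η : K) (n : ℕ) (hn : 0 < n)
    (h1 : η ^ n = 1) (hne : η ≠ 1) : GoodW (Module.finrank ℚ K) |Algebra.norm ℚ (1 - η)| := by
  have hm0 : 0 < orderOf η := orderOf_pos_iff.mpr (isOfFinOrder_iff_pow_eq_one.mpr ⟨n, hn, h1⟩)
  have hprim : IsPrimitiveRoot η (orderOf η) := IsPrimitiveRoot.orderOf η
  have hm1 : orderOf η ≠ 1 := by rwa [Ne, orderOf_eq_one_iff]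
  set m := orderOf η with hm
  clear_value m
  rcases eq_or_ne m 2 with rfl | hm2
  · have : (1 : K) - η = algebraMap ℚ K 2 := by
      rw [hprim.eq_neg_one_of_two_right]; simp; norm_num
    rw [this, Algebra.norm_algebraMap]
    exact ⟨2, Module.finrank ℚ K, by rw [abs_of_pos (by positivity)]; simp, Or.inr Nat.prime_two, by simp⟩
  have : NeZero m := ⟨hm0.ne'⟩
  have hcyc := hprim.intermediateField_adjoin_isCyclotomicExtension ℚ
  set E := IntermediateField.adjoin ℚ {η} with hE
  letI iA : Algebra ℚ E := IntermediateField.algebra' E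
  have hcyc' : IsCyclotomicExtension {m} ℚ E := hcyc
  let η' : E := ⟨η, IntermediateField.mem_adjoin_simple_self ℚ η⟩
  have hη' : IsPrimitiveRoot η' m := IsPrimitiveRoot.coe_submonoidClass_iff.mp hprim
  have hirr : Irreducible (cyclotomic m ℚ) := cyclotomic.irreducible_rat hm0
  have hnorm := hη'.sub_one_norm_eq_eval_cyclotomic (K := ℚ) (by omega) hirr
  have hfr : Module.finrank ℚ E = m.totient := IsCyclotomicExtension.finrank E hirr
  have hN : Algebra.norm ℚ (η - 1) = (Algebra.norm ℚ (η' - 1)) ^ (Module.finrank E K) := by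
    rw [← Algebra.norm_norm (S := E)]
    have : η - 1 = algebraMap E K (η' - 1) := by simp [η']
    rw [this, Algebra.norm_algebraMap, map_pow]
  have habs : |Algebra.norm ℚ (1 - η)| = |Algebra.norm ℚ (η - 1)| := by
    have : 1 - η = algebraMap ℚ K (-1) * (η - 1) := by simp
    rw [this, map_mul, Algebra.norm_algebraMap, abs_mul, abs_pow]; simp
  rw [habs, hN, hnorm]
  have hmul : Module.finrank ℚ E * Module.finrank E K = Module.finrank ℚ K := Module.finrank_mul_finrank ℚ E K
  by_cases hpp : ∃ p k : ℕ, p.Prime ∧ m = p ^ (k + 1)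
  · obtain ⟨p, k, hp, hpk⟩ := hpp
    have := Fact.mk hp
    refine ⟨p, Module.finrank E K, ?_, Or.inr hp, ?_⟩
    · rw [hpk, eval_one_cyclotomic_prime_pow]
      rw [abs_of_nonneg (by positivity)]; simp
    · rw [← hmul, hfr, hpk, Nat.totient_prime_pow_succ hp]
      have : 1 ≤ p ^ k := Nat.one_le_pow _ _ hp.pos
      nlinarith [Nat.zero_le (Module.finrank E K * (p - 1))]
  · refine ⟨1, 0, ?_, Or.inl rfl, by simp⟩
    rw [eval_one_cyclotomic_not_prime_pow]
    · simp
    · intro p hp k hk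
      rcases k with _ | k
      · simp at hk; omega
      · exact hpp ⟨p, k, hp, hk.symm⟩

lemma good_cr (n : ℕ) (hn : 0 < n) (ω : Fin 4 → ℂ) (h1 : ∀ i, ω i ^ n = 1) (hinj : Function.Injective ω) (r : ℚ)
    (h : (ω 0 - ω 2) * (ω 1 - ω 3) = r * ((ω 0 - ω 3) * (ω 1 - ω 2))) : GoodAbs |r| := by
  set K := IntermediateField.adjoin ℚ (Set.range ω) with hK
  have hfd : FiniteDimensional ℚ K := by
    apply IntermediateField.finiteDimensional_adjoin
    rintro x ⟨i, rfl⟩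
    refine ⟨Polynomial.X ^ n - 1, Polynomial.monic_X_pow_sub_C 1 hn.ne', ?_⟩
    simp [h1]
  let w : Fin 4 → K := fun i => ⟨ω i, IntermediateField.subset_adjoin ℚ _ ⟨i, rfl⟩⟩
  have hw : ∀ i, (w i : ℂ) = ω i := fun i => rfl
  have w1 : ∀ i, w i ^ n = 1 := fun i => by
    apply Subtype.ext; simp [hw, h1]
  have w0 : ∀ i, w i ≠ 0 := fun i h0 => by
    have := w1 i
    rw [h0, zero_pow hn.ne'] at this
    exact zero_ne_one this
  have hN1 : ∀ i, |Algebra.norm ℚ (w i)| = 1 := fun i => by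
    have := congrArg (fun x => |Algebra.norm ℚ x|) (w1 i)
    simp only [map_pow, map_one, abs_one, abs_pow] at this
    exact (pow_eq_one_iff_of_nonneg (abs_nonneg _) hn.ne').mp this
  have hgood : ∀ i j, i ≠ j → GoodW (Module.finrank ℚ K) |Algebra.norm ℚ (w i - w j)| := by
    intro i j hij
    have : w i - w j = w i * (1 - w j / w i) := by
      field_simp [w0 i]
    rw [this, map_mul, abs_mul, hN1, one_mul]
    apply goodW_norm _ n hn
    · rw [div_pow, w1, w1, div_one]
    · intro he
      rw [div_eq_one_iff_eq (w0 i)] at he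
      exact hij (hinj (congrArg Subtype.val he).symm)
  have hK' : (w 0 - w 2) * (w 1 - w 3) = algebraMap ℚ K r * ((w 0 - w 3) * (w 1 - w 2)) := by
    apply Subtype.ext
    simpa [hw] using h
  have hr : r ≠ 0 := by
    rintro rfl
    simp at h
    rcases h with h | h
    · exact absurd (hinj (sub_eq_zero.mp h)) (by decide)
    · exact absurd (hinj (sub_eq_zero.mp h)) (by decide)
  have hfin := congrArg (fun x => |Algebra.norm ℚ x|) hK'
  simp only [map_mul, Algebra.norm_algebraMap, abs_mul, abs_pow] at hfin
  exact good_of_val Module.finrank_pos |r| _ _ _ _ (abs_pos.mpr hr) (hgood 0 2 (by decide)) (hgood 1 3 (by decide))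
    (hgood 0 3 (by decide)) (hgood 1 2 (by decide)) hfin.symm

end PartNt

section PartPte
lemma newton_multiset (s : Multiset ℝ) (k : ℕ) : (k : ℝ) * s.esymm k = (-1) ^ (k + 1) *
      ∑ a ∈ Finset.HasAntidiagonal.antidiagonal k with a.1 < k, (-1) ^ a.1 * s.esymm a.1 * (s.map (· ^ a.2)).sum := by
  obtain ⟨f, hf⟩ : ∃ f : Fin s.card → ℝ, Finset.univ.val.map f = s := by
    refine ⟨fun i => s.toList.get (i.cast (by simp)), ?_⟩
    rw [Fin.univ_val_map]
    conv_rhs => rw [← Multiset.coe_toList s]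
    congr 1
    apply List.ext_get <;> simp
  have := congrArg (MvPolynomial.aeval f) (MvPolynomial.mul_esymm_eq_sum (Fin s.card) ℝ k)
  simp only [map_mul, map_sum, map_pow, map_neg, map_one, map_natCast,
    MvPolynomial.aeval_esymm_eq_multiset_esymm, hf] at this
  rw [this]
  congr 1
  apply Finset.sum_congr rfl
  intro a _
  congr 1
  simp only [MvPolynomial.psum, map_sum, map_pow, MvPolynomial.aeval_X]
  conv_rhs => rw [← hf]
  rw [Multiset.map_map]
  rfl

lemma multiset_eq_of_power_sums (s t : Multiset ℝ) (hc : s.card = t.card) 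
    (h : ∀ j ≤ s.card, (s.map (· ^ j)).sum = (t.map (· ^ j)).sum) : s = t := by
  have he : ∀ k ≤ s.card, s.esymm k = t.esymm k := by
    intro k
    induction k using Nat.strong_induction_on with
    | _ k ih =>
      intro hk
      rcases Nat.eq_zero_or_pos k with rfl | hk0
      · simp [Multiset.esymm]
      · have h1 := newton_multiset s k
        have h2 := newton_multiset t k
        have h3 : (k : ℝ) * s.esymm k = k * t.esymm k := by
          rw [h1, h2]
          congr 1
          apply Finset.sum_congr rfl
          intro a ha
          simp only [Finset.mem_filter, Finset.HasAntidiagonal.mem_antidiagonal] at ha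
          rw [ih a.1 ha.2 (by omega), h a.2 (by omega)]
        have : (k : ℝ) ≠ 0 := by positivity
        exact mul_left_cancel₀ this h3
  have hp : (s.map fun t => Polynomial.X - Polynomial.C t).prod = (t.map fun t => Polynomial.X - Polynomial.C t).prod := by
    rw [Multiset.prod_X_sub_X_eq_sum_esymm, Multiset.prod_X_sub_X_eq_sum_esymm, ← hc]
    apply Finset.sum_congr rfl
    intro j hj
    rw [he j (by simpa [Nat.lt_succ_iff] using hj)]
  have := congrArg Polynomial.roots hp
  rwa [Polynomial.roots_multiset_prod_X_sub_C, Polynomial.roots_multiset_prod_X_sub_C] at this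

/-- Prouhet–Tarry–Escott type bound. -/
lemma pte_bound {ι : Type*} (A B : Finset ι) (t : ι → ℝ) (k : ℕ) (hk : 0 < k)
    (hm : ∀ j < k, ∑ x ∈ A, t x ^ j = ∑ x ∈ B, t x ^ j) 
    (hne : ∃ h : ℝ, (A.filter (fun x => t x = h)).card ≠ (B.filter (fun x => t x = h)).card)
    (H : Finset ℝ) (hA : ∀ x ∈ A, t x ∈ H) (hB : ∀ x ∈ B, t x ∈ H) :
    2 * k ≤ ∑ h ∈ H, (((A.filter (fun x => t x = h)).card : ℤ) - ((B.filter (fun x => t x = h)).card : ℤ)).natAbs := by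
  classical
  set MA := A.val.map t with hMA
  set MB := B.val.map t with hMB
  have cA : ∀ h, (A.filter (fun x => t x = h)).card = MA.count h := by
    intro h
    rw [Multiset.count_map, Finset.card_def, Finset.filter_val]
    simp only [eq_comm]
  have cB : ∀ h, (B.filter (fun x => t x = h)).card = MB.count h := by
    intro h
    rw [Multiset.count_map, Finset.card_def, Finset.filter_val]
    simp only [eq_comm]
  simp only [cA, cB] at hne ⊢
  set P := MA - MB with hP
  set Q := MB - MA with hQ
  have hsum : ∑ h ∈ H, ((MA.count h : ℤ) - (MB.count h : ℤ)).natAbs = P.card + Q.card := by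
    have h1 : ∑ h ∈ H, P.count h = P.card := Multiset.sum_count_eq_card (fun a ha => by
      have := Multiset.mem_of_le (Multiset.sub_le_self _ _) ha
      rw [hMA, Multiset.mem_map] at this
      obtain ⟨x, hx, rfl⟩ := this
      exact hA x hx)
    have h2 : ∑ h ∈ H, Q.count h = Q.card := Multiset.sum_count_eq_card (fun a ha => by
      have := Multiset.mem_of_le (Multiset.sub_le_self _ _) ha
      rw [hMB, Multiset.mem_map] at this
      obtain ⟨x, hx, rfl⟩ := this
      exact hB x hx)
    rw [← h1, ← h2, ← Finset.sum_add_distrib]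
    apply Finset.sum_congr rfl
    intro h _
    rw [hP, hQ, Multiset.count_sub, Multiset.count_sub]
    omega
  have hmom : ∀ j < k, (P.map (· ^ j)).sum = (Q.map (· ^ j)).sum := by
    intro j hj
    have h1 : P + MA ∩ MB = MA := Multiset.sub_add_inter _ _
    have h2 : Q + MA ∩ MB = MB := by rw [Multiset.inter_comm]; exact Multiset.sub_add_inter _ _
    have h3 : (MA.map (· ^ j)).sum = (MB.map (· ^ j)).sum := by
      have := hm j hj
      simpa [hMA, hMB, Multiset.map_map] using this
    have h4 := congrArg (fun m => (m.map (· ^ j)).sum) h1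
    have h5 := congrArg (fun m => (m.map (· ^ j)).sum) h2
    simp only [Multiset.map_add, Multiset.sum_add] at h4 h5
    linarith
  have hcard : P.card = Q.card := by
    have := hmom 0 hk
    simp at this
    exact_mod_cast this
  rw [hsum]
  by_contra hlt
  have hPQ : P = Q := multiset_eq_of_power_sums P Q hcard (fun j hj => hmom j (by omega))
  obtain ⟨h, hh⟩ := hne
  have := congrArg (Multiset.count h) hPQ
  rw [hP, hQ, Multiset.count_sub, Multiset.count_sub] at this
  omega

lemma sum_height {ι : Type*} (A B : Finset ι) (t : ι → ℝ) 
    (h : ∀ h : ℝ, (A.filter (fun x => t x = h)).card = (B.filter (fun x => t x = h)).card) {M : Type*} [AddCommMonoid M]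
    (F : ℝ → M) : ∑ x ∈ A, F (t x) = ∑ x ∈ B, F (t x) := by
  classical
  have hAB : A.image t = B.image t := by
    ext y
    simp only [Finset.mem_image]
    have := h y
    have e : ∀ C : Finset ι, (∃ x ∈ C, t x = y) ↔ (C.filter (fun x => t x = y)).card ≠ 0 := by
      intro C
      simp [Finset.filter_eq_empty_iff]
    rw [e, e, this]
  rw [Finset.sum_comp, Finset.sum_comp, hAB]
  apply Finset.sum_congr rfl
  intro y _
  rw [h y]

open Polynomial in
lemma moments {ι : Type*} (A B : Finset ι) (p : ι → ℂ) (V : Finset ℂ) (u : ℂ) (hu : u ≠ 0)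
    (hV : ∀ v ∈ V, ∀ h : ℝ, (A.filter (fun x => (p x / v).im = h)).card = (B.filter (fun x => (p x / v).im = h)).card)
    (h0 : ∀ v ∈ V, (u / v).im ≠ 0) (hVV : ∀ v ∈ V, ∀ w ∈ V, v ≠ w → (v / w).im ≠ 0) (j : ℕ) (hj : j < V.card) :
    ∑ x ∈ A, (p x / u).im ^ j = ∑ x ∈ B, (p x / u).im ^ j := by
  classical
  let L : ι → ℝ[X] := fun x => (C ((p x / u).re) + C ((p x / u).im) * X) ^ j
  let G : ℝ[X] := ∑ x ∈ A, L x - ∑ x ∈ B, L x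
  let s : ℂ → ℝ := fun v => (u / v).re / (u / v).im
  have hdegL : ∀ x, (L x).natDegree ≤ j := by
    intro x
    refine (natDegree_pow_le).trans ?_
    have : (C ((p x / u).re) + C ((p x / u).im) * X).natDegree ≤ 1 := by compute_degree
    nlinarith
  have hdeg : G.natDegree ≤ j := by
    refine (natDegree_sub_le _ _).trans (max_le ?_ ?_) <;>
    exact natDegree_sum_le_of_forall_le _ _ (fun x _ => hdegL x)
  have hcoefL : ∀ x, (L x).coeff j = (p x / u).im ^ j := by
    intro x
    have h1 : (C ((p x / u).re) + C ((p x / u).im) * X).natDegree ≤ 1 := by compute_degree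
    have := coeff_pow_of_natDegree_le (m := j) h1
    rw [mul_one] at this
    simp only [L]
    rw [this]; simp
  have hev : ∀ v ∈ V, G.eval (s v) = 0 := by
    intro v hv
    have hLv : ∀ x, (L x).eval (s v) = ((p x / v).im / (u / v).im) ^ j := by
      intro x
      simp only [L, s, eval_pow, eval_add, eval_C, eval_mul, eval_X]
      congr 1
      have hh := h0 v hv
      have e : p x / v = (p x / u) * (u / v) := by field_simp
      rw [e, Complex.mul_im]
      field_simp
    simp only [G, eval_sub, eval_finsetSum, hLv]
    rw [sub_eq_zero]
    exact sum_height A B (fun x => (p x / v).im) (hV v hv) (fun y => (y / (u / v).im) ^ j)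
  have hinj : Set.InjOn s V := by
    intro v hv w hw hvw
    by_contra hne
    apply hVV v hv w hw hne
    have h1 := h0 v hv
    have h2 := h0 w hw
    simp only [s] at hvw
    have hv0 : v ≠ 0 := by rintro rfl; simp at h1
    have e : v / w = (u / w) / (u / v) := by field_simp
    rw [e, Complex.div_im]
    have hvw' : (u / v).re * (u / w).im = (u / w).re * (u / v).im := by
      field_simp at hvw
      linarith
    rw [← sub_div]
    rw [div_eq_zero_iff]; left; linarith
  have hG : G = 0 := by
    apply eq_zero_of_natDegree_lt_card_of_eval_eq_zero' G (V.image s)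
    · intro i hi
      obtain ⟨v, hv, rfl⟩ := Finset.mem_image.mp hi
      exact hev v hv
    · rw [Finset.card_image_of_injOn hinj]; omega
  have := congrArg (fun q => coeff q j) hG
  simp only [G, coeff_sub, finsetSum_coeff, hcoefL, coeff_zero] at this
  linarith

end PartPte

section PartOd
lemma blocks_aux (ε : ℝ → Prop) (H : Finset ℝ) : H.Nonempty → ∃ (q : ℕ) (b : ℝ → ℕ) (e : ℕ), 0 < q ∧
    (∀ h ∈ H, ∀ g ∈ H, h ≤ g → b h ≤ b g) ∧ (∀ h ∈ H, b h < q) ∧ (∀ j < q, ∃ h ∈ H, b h = j) ∧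
    (∀ h ∈ H, (ε h ↔ (b h + e) % 2 = 0)) := by
  classical
  induction H using Finset.induction_on_max with
  | empty => intro h; simp at h
  | insert a s hs ih =>
    intro _
    have has : a ∉ s := fun h => lt_irrefl _ (hs a h)
    rcases s.eq_empty_or_nonempty with rfl | hne
    · refine ⟨1, fun _ => 0, if ε a then 0 else 1, one_pos, by simp, by simp, ?_, ?_⟩
      · intro j hj; exact ⟨a, by simp, by show 0 = j; omega⟩
      · intro h hh
        simp at hh
        subst hh
        split_ifs with hε <;> simp [hε]
    · obtain ⟨q, b, e, hq, hmono, hlt, hsurj, hpar⟩ := ih hne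
      have hb : ∀ c : ℕ, ∀ h ∈ s, Function.update b a c h = b h := fun c h hh => by
        rw [Function.update_of_ne]; rintro rfl; exact has hh
      by_cases hε : (ε a ↔ (q - 1 + e) % 2 = 0)
      · refine ⟨q, Function.update b a (q - 1), e, hq, ?_, ?_, ?_, ?_⟩
        · intro h hh g hg hhg
          rcases Finset.mem_insert.mp hh with rfl | hh' <;> rcases Finset.mem_insert.mp hg with rfl | hg'
          · exact le_rfl
          · exact absurd (hs g hg') (not_lt.mpr hhg)
          · rw [hb _ h hh']; simp; have := hlt h hh'; omega
          · rw [hb _ h hh', hb _ g hg']; exact hmono h hh' g hg' hhg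
        · intro h hh
          rcases Finset.mem_insert.mp hh with rfl | hh'
          · simp; omega
          · rw [hb _ h hh']; exact hlt h hh'
        · intro j hj
          obtain ⟨h, hh, rfl⟩ := hsurj j hj
          exact ⟨h, Finset.mem_insert_of_mem hh, hb _ h hh⟩
        · intro h hh
          rcases Finset.mem_insert.mp hh with rfl | hh'
          · simpa using hε
          · rw [hb _ h hh']; exact hpar h hh'
      · refine ⟨q + 1, Function.update b a q, e, by omega, ?_, ?_, ?_, ?_⟩
        · intro h hh g hg hhg
          rcases Finset.mem_insert.mp hh with rfl | hh' <;> rcases Finset.mem_insert.mp hg with rfl | hg'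
          · exact le_rfl
          · exact absurd (hs g hg') (not_lt.mpr hhg)
          · rw [hb _ h hh']; simp; have := hlt h hh'; omega
          · rw [hb _ h hh', hb _ g hg']; exact hmono h hh' g hg' hhg
        · intro h hh
          rcases Finset.mem_insert.mp hh with rfl | hh'
          · simp
          · rw [hb _ h hh']; have := hlt h hh'; omega
        · intro j hj
          rcases Nat.lt_succ_iff_lt_or_eq.mp hj with hj | rfl
          · obtain ⟨h, hh, rfl⟩ := hsurj j hj
            exact ⟨h, Finset.mem_insert_of_mem hh, hb _ h hh⟩
          · exact ⟨a, by simp, by simp⟩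
        · intro h hh
          rcases Finset.mem_insert.mp hh with rfl | hh'
          · simp only [Function.update_self]
            by_cases h1 : ε h
            · simp only [h1, true_iff] at hε ⊢; omega
            · simp only [h1, false_iff] at hε ⊢; omega
          · rw [hb _ h hh']; exact hpar h hh'

lemma conv_between {K : Set ℂ} (hK : Convex ℝ K) {c e x : ℂ} (hc : c ∈ K) (he : e ∈ K)
    (h1 : c.im = x.im) (h2 : e.im = x.im) (h3 : c.re ≤ x.re) (h4 : x.re ≤ e.re) : x ∈ K := by
  rcases eq_or_lt_of_le (h3.trans h4) with h | h
  · have : x = c := Complex.ext (by linarith) h1.symm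
    rwa [this]
  · have hd : 0 < e.re - c.re := by linarith
    have := hK hc he (a := (e.re - x.re) / (e.re - c.re)) (b := (x.re - c.re) / (e.re - c.re))
      (by apply div_nonneg <;> linarith) (by apply div_nonneg <;> linarith) (by field_simp; ring)
    convert this using 1
    apply Complex.ext
    · simp only [Complex.add_re, Complex.smul_re, smul_eq_mul]; field_simp; ring
    · simp only [Complex.add_im, Complex.smul_im, smul_eq_mul, h1, h2]; field_simp; ring

lemma cross_pos {K : Set ℂ} (hK : Convex ℝ K) {c y x : ℂ} (h0 : (0:ℂ) ∈ K) (hc : c ∈ K) (hy : y ∈ K) (hx : x ∉ K)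
    (h1 : c.im = x.im) (hp : 0 < x.im) (h2 : x.im ≤ y.im) :
    (c.re < x.re → 0 < x.re * y.im - x.im * y.re) ∧ (x.re < c.re → x.re * y.im - x.im * y.re < 0) := by
  have hy0 : 0 < y.im := by linarith
  have he : ((x.im / y.im : ℝ) : ℂ) * y ∈ K := by
    have := hK h0 hy (a := 1 - x.im / y.im) (b := x.im / y.im) (by
      rw [sub_nonneg, div_le_one hy0]; exact h2) (by positivity) (by ring)
    simpa using this
  have him : (((x.im / y.im : ℝ) : ℂ) * y).im = x.im := by
    rw [Complex.im_ofReal_mul]; field_simp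
  have hre : (((x.im / y.im : ℝ) : ℂ) * y).re = x.im * y.re / y.im := by
    rw [Complex.re_ofReal_mul]; ring
  constructor
  · intro h
    by_contra hcon
    apply hx
    apply conv_between hK hc he h1 him h.le
    rw [hre, le_div_iff₀ hy0]; linarith
  · intro h
    by_contra hcon
    apply hx
    apply conv_between hK he hc him h1 _ h.le
    rw [hre, div_le_iff₀ hy0]; linarith

lemma cross_level {K : Set ℂ} (hK : Convex ℝ K) {c x : ℂ} (h0 : (0:ℂ) ∈ K) (hc : c ∈ K) (hx : x ∉ K)
    (h1 : c.im = x.im) (hp : x.im = 0) :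
    (c.re < x.re → 0 < x.re) ∧ (x.re < c.re → x.re < 0) := by
  constructor
  · intro h
    by_contra hcon
    exact hx (conv_between hK hc h0 h1 (by simp [hp]) h.le (by simpa using hcon))
  · intro h
    by_contra hcon
    exact hx (conv_between hK h0 hc (by simp [hp]) h1 (by simpa using hcon) h.le)

lemma cross_neg {K : Set ℂ} (hK : Convex ℝ K) {c y x : ℂ} (h0 : (0:ℂ) ∈ K) (hc : c ∈ K) (hy : y ∈ K) (hx : x ∉ K)
    (h1 : c.im = x.im) (hp : x.im < 0) (h2 : y.im ≤ x.im) :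
    (x.re < c.re → 0 < x.re * y.im - x.im * y.re) ∧ (c.re < x.re → x.re * y.im - x.im * y.re < 0) := by
  have := cross_pos (K := -K) hK.neg (c := -c) (y := -y) (x := -x) (by simpa using h0) (by simpa using hc) (by simpa using hy)
    (by simpa using hx) (by simpa using h1) (by simpa using hp) (by simpa using h2)
  simpa using this

lemma arg_lt_of_cross {x y : ℂ} (h : (0 < x.im ∧ 0 < y.im) ∨ (x.im < 0 ∧ y.im < 0))
    (hc : 0 < x.re * y.im - x.im * y.re) : x.arg < y.arg := by
  have hx0 : x ≠ 0 := by rintro rfl; simp at h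
  have hy0 : y ≠ 0 := by rintro rfl; simp at h
  have e : x.re * y.im - x.im * y.re = ‖x‖ * ‖y‖ * Real.sin (y.arg - x.arg) := by
    rw [Real.sin_sub]
    have a1 := Complex.norm_mul_cos_arg x
    have a2 := Complex.norm_mul_cos_arg y
    have a3 := Complex.norm_mul_sin_arg x
    have a4 := Complex.norm_mul_sin_arg y
    rw [← a1, ← a2, ← a3, ← a4]; ring
  rw [e] at hc
  have hs : 0 < Real.sin (y.arg - x.arg) := by
    have : 0 < ‖x‖ * ‖y‖ := by positivity
    exact pos_of_mul_pos_right hc this.le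
  by_contra hcon
  have hd : -Real.pi ≤ y.arg - x.arg := by
    rcases h with ⟨h1, h2⟩ | ⟨h1, h2⟩
    · have := Complex.arg_nonneg_iff.mpr h2.le
      have := Complex.arg_le_pi x
      linarith
    · have := Complex.arg_neg_iff.mpr h1
      have := Complex.neg_pi_lt_arg y
      linarith
  have := Real.sin_nonpos_of_nonpos_of_neg_pi_le (by linarith : y.arg - x.arg ≤ 0) hd
  linarith

/-- the abstract angle comparison -/
lemma arg_facts {x : ℂ} : (0 < x.im → 0 < x.arg ∧ x.arg < Real.pi) ∧ (x.im < 0 → -Real.pi < x.arg ∧ x.arg < 0) ∧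
    (x.im = 0 → 0 < x.re → x.arg = 0) ∧ (x.im = 0 → x.re < 0 → x.arg = Real.pi) := by
  refine ⟨fun h => ⟨?_, ?_⟩, fun h => ⟨Complex.neg_pi_lt_arg x, Complex.arg_neg_iff.mpr h⟩, fun h h' => ?_, fun h h' => ?_⟩
  · rcases lt_or_eq_of_le (Complex.arg_nonneg_iff.mpr h.le) with h1 | h1
    · exact h1
    · have := (Complex.arg_eq_zero_iff.mp h1.symm).2; linarith
  · rcases lt_or_eq_of_le (Complex.arg_le_pi x) with h1 | h1
    · exact h1
    · have := (Complex.arg_eq_pi_iff.mp h1).2; linarith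
  · exact Complex.arg_eq_zero_iff.mpr ⟨h'.le, h⟩
  · exact Complex.arg_eq_pi_iff.mpr ⟨h', h⟩

end PartOd

section PartOd2
noncomputable def thR (r : Prop) (z : ℂ) : ℝ := by
  classical exact z.arg + 2 * Real.pi * ((if (¬ r ∧ z.im < 0) then 1 else 0 : ℤ) : ℝ)

set_option linter.unusedSimpArgs false in
set_option maxHeartbeats 400000 in
lemma order_core {K1 K2 : Set ℂ} (hK1 : Convex ℝ K1) (hK2 : Convex ℝ K2) {x y cx cy : ℂ} {Rx Ry : Prop}
    (z1 : (0:ℂ) ∈ K1) (z2 : (0:ℂ) ∈ K2) (y1 : y ∈ K1) (c1 : cx ∈ K1) (x1 : x ∉ K1)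
    (x2 : x ∈ K2) (c2 : cy ∈ K2) (y2 : y ∉ K2) (hcx : cx.im = x.im) (hcy : cy.im = y.im)
    (r1 : Rx → cx.re < x.re) (r2 : ¬ Rx → x.re < cx.re) (s1 : Ry → cy.re < y.re) (s2 : ¬ Ry → y.re < cy.re)
    (hxy : x.im ≤ y.im) (heq : x.im = y.im → (Rx ↔ ¬ Ry)) :
    (Rx → thR Rx x < thR Ry y ∧ thR Ry y < thR Rx x + 2 * Real.pi) ∧
    (¬ Rx → thR Ry y < thR Rx x ∧ thR Rx x < thR Ry y + 2 * Real.pi) := by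
  have hpi := Real.pi_pos
  obtain ⟨ax1, ax2, ax3, ax4⟩ := @arg_facts x
  obtain ⟨ay1, ay2, ay3, ay4⟩ := @arg_facts y
  rcases lt_trichotomy x.im 0 with hx | hx | hx
  · obtain ⟨ax, ax'⟩ := ax2 hx
    rcases lt_trichotomy y.im 0 with hy | hy | hy
    · obtain ⟨ay, ay'⟩ := ay2 hy
      obtain ⟨n1, n2⟩ := cross_neg hK2 z2 c2 x2 y2 hcy hy hxy
      have k1 : Ry → x.arg < y.arg := fun h => arg_lt_of_cross (Or.inr ⟨hx, hy⟩) (by have := n2 (s1 h); linarith)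
      have k2 : ¬ Ry → y.arg < x.arg := fun h => arg_lt_of_cross (Or.inr ⟨hy, hx⟩) (n1 (s2 h))
      by_cases hr : Rx <;> by_cases hs : Ry <;> simp only [hr, hs, thR, hx, hy, not_true, not_false_iff, and_true, and_false, false_and, if_true, if_false, true_imp_iff, false_imp_iff, Int.cast_one, Int.cast_zero, and_self, true_and]
      · have := k1 hs; constructor <;> linarith
      · have := k2 hs; constructor <;> linarith
      · have := k1 hs; constructor <;> linarith
      · have := k2 hs; constructor <;> linarith
    · obtain ⟨l1, l2⟩ := cross_level hK2 z2 c2 y2 hcy hy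
      have k1 : Ry → y.arg = 0 := fun h => ay3 hy (l1 (s1 h))
      have k2 : ¬ Ry → y.arg = Real.pi := fun h => ay4 hy (l2 (s2 h))
      by_cases hr : Rx <;> by_cases hs : Ry <;> simp only [hr, hs, thR, hx, hy, lt_irrefl, not_true, not_false_iff, and_true, and_false, false_and, if_true, if_false, true_imp_iff, false_imp_iff, Int.cast_one, Int.cast_zero, and_self, true_and]
      · have := k1 hs; constructor <;> linarith
      · have := k2 hs; constructor <;> linarith
      · have := k1 hs; constructor <;> linarith
      · have := k2 hs; constructor <;> linarith
    · obtain ⟨ay, ay'⟩ := ay1 hy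
      have hy2 : ¬ y.im < 0 := by linarith
      by_cases hr : Rx <;> simp only [hr, thR, hx, hy2, not_true, not_false_iff, and_true, and_false, false_and, if_true, if_false, true_imp_iff, false_imp_iff, Int.cast_one, Int.cast_zero, and_self, true_and]
      · constructor <;> linarith
      · constructor <;> linarith
  · obtain ⟨l1, l2⟩ := cross_level hK1 z1 c1 x1 hcx hx
    have k1 : Rx → x.arg = 0 := fun h => ax3 hx (l1 (r1 h))
    have k2 : ¬ Rx → x.arg = Real.pi := fun h => ax4 hx (l2 (r2 h))
    have hx2 : ¬ x.im < 0 := by linarith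
    have hy2 : ¬ y.im < 0 := by linarith
    simp only [thR, hx2, hy2, and_false, if_false, Int.cast_zero]
    rcases eq_or_lt_of_le hxy with hy | hy
    · obtain ⟨l1, l2⟩ := cross_level hK2 z2 c2 y2 hcy (by rw [← hy, hx])
      have k3 : Ry → y.arg = 0 := fun h => ay3 (by rw [← hy, hx]) (l1 (s1 h))
      have k4 : ¬ Ry → y.arg = Real.pi := fun h => ay4 (by rw [← hy, hx]) (l2 (s2 h))
      have := heq hy
      refine ⟨fun h => ?_, fun h => ?_⟩
      · have a := k1 h; have b := k4 (this.1 h); constructor <;> linarith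
      · have a := k2 h; have b := k3 (not_not.mp (fun h' => h (this.2 h'))); constructor <;> linarith
    · obtain ⟨ay, ay'⟩ := ay1 (by linarith)
      refine ⟨fun h => ?_, fun h => ?_⟩
      · have a := k1 h; constructor <;> linarith
      · have a := k2 h; constructor <;> linarith
  · have hx2 : ¬ x.im < 0 := by linarith
    have hy2 : ¬ y.im < 0 := by linarith
    simp only [thR, hx2, hy2, and_false, if_false, Int.cast_zero]
    obtain ⟨ax, ax'⟩ := ax1 hx
    have hy : 0 < y.im := by linarith
    obtain ⟨ay, ay'⟩ := ay1 hy
    obtain ⟨n1, n2⟩ := cross_pos hK1 z1 c1 y1 x1 hcx hx hxy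
    refine ⟨fun h => ?_, fun h => ?_⟩
    · have := arg_lt_of_cross (Or.inl ⟨hx, hy⟩) (n1 (r1 h)); constructor <;> linarith
    · have := arg_lt_of_cross (Or.inl ⟨hy, hx⟩) (by have := n2 (r2 h); linarith); constructor <;> linarith

/-- Conclusion of the one-direction analysis. -/
structure OneDir {ι : Type*} [DecidableEq ι] (A B : Finset ι) (p : ι → ℂ) (q : ℕ) (i m : ι → ℤ) : Prop where
  qpos : 0 < q
  ran : ∀ x ∈ symmDiff A B, 0 ≤ i x ∧ i x < 2 * q
  surj : ∀ j : ℤ, 0 ≤ j → j < 2 * q → ∃ x ∈ symmDiff A B, i x = j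
  par : ∃ e : ℤ, (∀ x ∈ A \ B, (i x + e) % 2 = 0) ∧ (∀ x ∈ B \ A, (i x + e) % 2 = 1)
  ord : ∀ x ∈ A \ B, ∀ y ∈ B \ A,
    (i x < i y → (p x).arg + 2 * Real.pi * m x < (p y).arg + 2 * Real.pi * m y ∧
      (p y).arg + 2 * Real.pi * m y < (p x).arg + 2 * Real.pi * m x + 2 * Real.pi) ∧
    (i y < i x → (p y).arg + 2 * Real.pi * m y < (p x).arg + 2 * Real.pi * m x ∧
      (p x).arg + 2 * Real.pi * m x < (p y).arg + 2 * Real.pi * m y + 2 * Real.pi)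
  nz : ∀ x ∈ symmDiff A B, p x ≠ 0
  e1 : ∑ x ∈ symmDiff A B, Real.sin (Real.pi * (2 * i x + 1) / (2 * q)) * (p x).im = 0
  e3 : ∑ x ∈ symmDiff A B, Real.sin (Real.pi * (2 * i x + 1) / (2 * q)) * (p x).re ≠ 0

set_option maxHeartbeats 400000 in
theorem one_dir {ι : Type*} [DecidableEq ι] (A B : Finset ι) (p : ι → ℂ)
    (hX : ∀ h : ℝ, (A.filter (fun x => (p x).im = h)).card = (B.filter (fun x => (p x).im = h)).card)
    (hA : ∀ x ∈ A, x ∉ B → p x ∉ convexHull ℝ (p '' (B : Set ι)))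
    (hB : ∀ x ∈ B, x ∉ A → p x ∉ convexHull ℝ (p '' (A : Set ι)))
    (h0A : (0:ℂ) ∈ convexHull ℝ (p '' (A : Set ι))) (h0B : (0:ℂ) ∈ convexHull ℝ (p '' (B : Set ι)))
    (hne : A ≠ B) : ∃ q i m, OneDir A B p q i m := by
  classical
  set KA := convexHull ℝ (p '' (A : Set ι)) with hKA
  set KB := convexHull ℝ (p '' (B : Set ι)) with hKB
  have cKA : Convex ℝ KA := convex_convexHull _ _
  have cKB : Convex ℝ KB := convex_convexHull _ _
  have mA : ∀ x ∈ A, p x ∈ KA := fun x hx => subset_convexHull _ _ ⟨x, hx, rfl⟩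
  have mB : ∀ x ∈ B, p x ∈ KB := fun x hx => subset_convexHull _ _ ⟨x, hx, rfl⟩
  have hX' : ∀ h : ℝ, ((A \ B).filter (fun x => (p x).im = h)).card = ((B \ A).filter (fun x => (p x).im = h)).card := by
    intro h
    have e1 : (A \ B).filter (fun x => (p x).im = h) = A.filter (fun x => (p x).im = h) \ B.filter (fun x => (p x).im = h) := by
      ext x; simp; tauto
    have e2 : (B \ A).filter (fun x => (p x).im = h) = B.filter (fun x => (p x).im = h) \ A.filter (fun x => (p x).im = h) := by
      ext x; simp; tauto
    rw [e1, e2]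
    exact Finset.card_sdiff_comm (hX h)
  set D := symmDiff A B with hD
  have memD : ∀ x, x ∈ D ↔ (x ∈ A \ B ∨ x ∈ B \ A) := fun x => by rw [hD, Finset.mem_symmDiff]; simp
  have hDne : D.Nonempty := by
    rw [Finset.nonempty_iff_ne_empty]
    intro h
    exact hne (symmDiff_eq_bot.mp h)
  have compA : ∀ x ∈ A \ B, ∃ c ∈ B \ A, (p c).im = (p x).im := by
    intro x hx
    have : 0 < ((B \ A).filter (fun y => (p y).im = (p x).im)).card := by
      rw [← hX']; exact Finset.card_pos.mpr ⟨x, by simp only [Finset.mem_filter]; exact ⟨hx, trivial⟩⟩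
    obtain ⟨c, hc⟩ := Finset.card_pos.mp this
    exact ⟨c, (Finset.mem_filter.mp hc).1, (Finset.mem_filter.mp hc).2⟩
  have compB : ∀ x ∈ B \ A, ∃ c ∈ A \ B, (p c).im = (p x).im := by
    intro x hx
    have : 0 < ((A \ B).filter (fun y => (p y).im = (p x).im)).card := by
      rw [hX']; exact Finset.card_pos.mpr ⟨x, by simp only [Finset.mem_filter]; exact ⟨hx, trivial⟩⟩
    obtain ⟨c, hc⟩ := Finset.card_pos.mp this
    exact ⟨c, (Finset.mem_filter.mp hc).1, (Finset.mem_filter.mp hc).2⟩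
  have nA : ∀ x ∈ A \ B, p x ∈ KA ∧ p x ∉ KB := fun x hx => by
    rw [Finset.mem_sdiff] at hx; exact ⟨mA x hx.1, hA x hx.1 hx.2⟩
  have nB : ∀ x ∈ B \ A, p x ∈ KB ∧ p x ∉ KA := fun x hx => by
    rw [Finset.mem_sdiff] at hx; exact ⟨mB x hx.1, hB x hx.1 hx.2⟩
  let AR : ℝ → Prop := fun h => ∃ x ∈ A \ B, ∃ y ∈ B \ A, (p x).im = h ∧ (p y).im = h ∧ (p y).re < (p x).re
  have har1 : ∀ x ∈ A \ B, ∀ y ∈ B \ A, (p x).im = (p y).im → AR (p x).im → (p y).re < (p x).re := by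
    rintro x hx y hy hxy ⟨x', hx', y', hy', ex, ey, hlt⟩
    by_contra hcon
    push Not at hcon
    rcases le_total (p x).re (p y').re with h | h
    · exact (nB y' hy').2 (conv_between cKA (nA x hx).1 (nA x' hx').1 (by rw [ey]) (by rw [ex, ey]) h hlt.le)
    · exact (nA x hx).2 (conv_between cKB (nB y' hy').1 (nB y hy).1 ey hxy.symm h hcon)
  have har2 : ∀ x ∈ A \ B, ∀ y ∈ B \ A, (p x).im = (p y).im → ¬ AR (p x).im → (p x).re < (p y).re := by
    intro x hx y hy hxy hn
    have h1 : (p x).re ≤ (p y).re := by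
      by_contra hcon
      exact hn ⟨x, hx, y, hy, rfl, hxy.symm, not_le.mp hcon⟩
    refine lt_of_le_of_ne h1 fun h => ?_
    have : p x = p y := Complex.ext h hxy
    exact (nA x hx).2 (this ▸ (nB y hy).1)
  let R : ι → Prop := fun x => (x ∈ A ↔ AR (p x).im)
  obtain ⟨q, b, e, hq, hmono, hlt, hsurj, hpar⟩ := blocks_aux AR (D.image (fun x => (p x).im)) (hDne.image _)
  have hH : ∀ x ∈ D, (p x).im ∈ D.image (fun x => (p x).im) := fun x hx => Finset.mem_image_of_mem _ hx
  let i : ι → ℤ := fun x => if R x then (b (p x).im : ℤ) else 2 * q - 1 - b (p x).im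
  let m : ι → ℤ := fun x => if (¬ R x ∧ (p x).im < 0) then 1 else 0
  have hth : ∀ x, (p x).arg + 2 * Real.pi * m x = thR (R x) (p x) := fun x => by simp only [thR, m]; congr
  have RA : ∀ x ∈ A \ B, (R x ↔ AR (p x).im) := fun x hx => by simp only [R, (Finset.mem_sdiff.mp hx).1, true_iff]
  have RB : ∀ x ∈ B \ A, (R x ↔ ¬ AR (p x).im) := fun x hx => by simp only [R, (Finset.mem_sdiff.mp hx).2, false_iff]
  have AD : ∀ x ∈ A \ B, x ∈ D := fun x hx => (memD x).2 (Or.inl hx)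
  have BD : ∀ x ∈ B \ A, x ∈ D := fun x hx => (memD x).2 (Or.inr hx)
  -- parity of the blocks
  have parA : ∀ x ∈ A \ B, (i x + e) % 2 = 0 := by
    intro x hx
    have h1 := hpar _ (hH x (AD x hx))
    have h2 := hlt _ (hH x (AD x hx))
    simp only [i, RA x hx]
    split_ifs with h
    · rw [h1] at h; omega
    · rw [h1] at h; omega
  have parB : ∀ x ∈ B \ A, (i x + e) % 2 = 1 := by
    intro x hx
    have h1 := hpar _ (hH x (BD x hx))
    have h2 := hlt _ (hH x (BD x hx))
    simp only [i, RB x hx]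
    split_ifs with h
    · rw [h1] at h; omega
    · rw [h1] at h; omega
  have hiR : ∀ x, R x → i x = b (p x).im := fun x h => if_pos h
  have hiL : ∀ x, ¬ R x → i x = 2 * q - 1 - b (p x).im := fun x h => if_neg h
  have iord : ∀ x ∈ D, ∀ y ∈ D, i x ≠ i y → (p x).im ≤ (p y).im → (R x → i x < i y) ∧ (¬ R x → i y < i x) := by
    intro x hx y hy hne hle
    have h1 := hmono _ (hH x hx) _ (hH y hy) hle
    have h2 := hlt _ (hH x hx)
    have h3 := hlt _ (hH y hy)
    by_cases hr : R x <;> by_cases hs : R y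
    · have := hiR x hr; have := hiR y hs; refine ⟨fun _ => by omega, fun h => absurd hr h⟩
    · have := hiR x hr; have := hiL y hs; refine ⟨fun _ => by omega, fun h => absurd hr h⟩
    · have := hiL x hr; have := hiR y hs; refine ⟨fun h => absurd h hr, fun _ => by omega⟩
    · have := hiL x hr; have := hiL y hs; refine ⟨fun h => absurd h hr, fun _ => by omega⟩
  have rel : ∀ x ∈ A \ B, ∀ c ∈ B \ A, (p c).im = (p x).im → (R x → (p c).re < (p x).re) ∧ (¬ R x → (p x).re < (p c).re)
      ∧ (R c → (p x).re < (p c).re) ∧ (¬ R c → (p c).re < (p x).re) ∧ (R x ↔ ¬ R c) := by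
    intro x hx c hc h
    rw [RA x hx, RB c hc, h]
    refine ⟨har1 x hx c hc h.symm, har2 x hx c hc h.symm, har2 x hx c hc h.symm, fun h' => har1 x hx c hc h.symm (not_not.mp h'), not_not.symm⟩
  have csin : ∀ x ∈ D, Real.sin (Real.pi * (2 * i x + 1) / (2 * q)) =
      (if R x then 1 else -1) * Real.sin (Real.pi * (2 * b (p x).im + 1) / (2 * q)) := by
    intro x hx
    have hq' : (q:ℝ) ≠ 0 := by positivity
    by_cases h : R x
    · rw [if_pos h, hiR x h]; push_cast; ring
    · rw [if_neg h, hiL x h]; push_cast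
      have : Real.pi * (2 * (2 * q - 1 - b (p x).im) + 1) / (2 * q) = 2 * Real.pi - Real.pi * (2 * b (p x).im + 1) / (2 * q) := by
        field_simp; ring
      rw [this, Real.sin_two_pi_sub]; ring
  have spos : ∀ x ∈ D, 0 < Real.sin (Real.pi * (2 * b (p x).im + 1) / (2 * q)) := by
    intro x hx
    have h2 : (b (p x).im : ℝ) + 1 ≤ q := by exact_mod_cast hlt _ (hH x hx)
    have hq' : (0:ℝ) < q := by positivity
    have hpi := Real.pi_pos
    apply Real.sin_pos_of_pos_of_lt_pi
    · positivity
    · rw [div_lt_iff₀ (by positivity)]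
      nlinarith
  have E1 : ∀ F : ℝ → ℝ, ∑ x ∈ D, Real.sin (Real.pi * (2 * i x + 1) / (2 * q)) * F (p x).im = 0 := by
    intro F
    have hdisj : Disjoint (A \ B) (B \ A) := disjoint_sdiff_sdiff
    have hDU : D = (A \ B) ∪ (B \ A) := rfl
    rw [hDU, Finset.sum_union hdisj]
    let G : ℝ → ℝ := fun h => (if AR h then 1 else -1) * Real.sin (Real.pi * (2 * b h + 1) / (2 * q)) * F h
    have s1 : ∑ x ∈ A \ B, Real.sin (Real.pi * (2 * i x + 1) / (2 * q)) * F (p x).im = ∑ x ∈ A \ B, G (p x).im := by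
      apply Finset.sum_congr rfl
      intro x hx
      rw [csin x (AD x hx)]
      simp only [RA x hx, G]
    have s2 : ∑ x ∈ B \ A, Real.sin (Real.pi * (2 * i x + 1) / (2 * q)) * F (p x).im = - ∑ x ∈ B \ A, G (p x).im := by
      rw [← Finset.sum_neg_distrib]
      apply Finset.sum_congr rfl
      intro x hx
      rw [csin x (BD x hx)]
      simp only [RB x hx, G]
      split_ifs <;> ring
    rw [s1, s2, sum_height (A \ B) (B \ A) (fun x => (p x).im) hX' G]
    ring
  have exR : ∀ x ∈ D, (∃ y ∈ D, (p y).im = (p x).im ∧ R y) ∧ (∃ y ∈ D, (p y).im = (p x).im ∧ ¬ R y) := by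
    intro x hx
    rcases (memD x).1 hx with h | h
    · obtain ⟨c, hc, e⟩ := compA x h
      have := (rel x h c hc e).2.2.2.2
      by_cases hr : R x
      · exact ⟨⟨x, hx, rfl, hr⟩, ⟨c, BD c hc, e, this.1 hr⟩⟩
      · exact ⟨⟨c, BD c hc, e, not_not.mp (fun h' => hr (this.2 h'))⟩, ⟨x, hx, rfl, hr⟩⟩
    · obtain ⟨c, hc, e⟩ := compB x h
      have := (rel c hc x h e.symm).2.2.2.2
      by_cases hr : R x
      · exact ⟨⟨x, hx, rfl, hr⟩, ⟨c, AD c hc, e, fun h' => this.1 h' hr⟩⟩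
      · exact ⟨⟨c, AD c hc, e, this.2 hr⟩, ⟨x, hx, rfl, hr⟩⟩
  have RLlt : ∀ x ∈ D, ∀ y ∈ D, (p x).im = (p y).im → R x → ¬ R y → (p y).re < (p x).re := by
    intro x hx y hy hxy hr hl
    rcases (memD x).1 hx with h | h <;> rcases (memD y).1 hy with h' | h'
    · exfalso; apply hl; rw [RA y h', ← hxy]; exact (RA x h).1 hr
    · exact (rel x h y h' hxy.symm).1 hr
    · exact (rel y h' x h hxy).2.1 hl
    · exfalso; apply hl; rw [RB y h', ← hxy]; exact (RB x h).1 hr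
  have hM : ∀ h : ℝ, ∃ M : ℝ, ∀ x ∈ D, (p x).im = h → (R x → M ≤ (p x).re) ∧ (¬ R x → (p x).re < M) := by
    intro h
    by_cases hh : ∃ x ∈ D, (p x).im = h
    · obtain ⟨x, hx, rfl⟩ := hh
      obtain ⟨y, hy, e1, hr⟩ := (exR x hx).1
      obtain ⟨y0, hy0, hmin⟩ := Finset.exists_min_image (D.filter (fun z => (p z).im = (p x).im ∧ R z)) (fun z => (p z).re)
        ⟨y, Finset.mem_filter.mpr ⟨hy, e1, hr⟩⟩
      rw [Finset.mem_filter] at hy0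
      refine ⟨(p y0).re, fun z hz hzx => ⟨fun hrz => hmin z (Finset.mem_filter.mpr ⟨hz, hzx, hrz⟩), fun hrz => ?_⟩⟩
      exact RLlt y0 hy0.1 z hz (by rw [hy0.2.1, hzx]) hy0.2.2 hrz
    · exact ⟨0, fun x hx hxh => absurd ⟨x, hx, hxh⟩ hh⟩
  choose M hM using hM
  refine ⟨q, i, m, ⟨hq, ?_, ?_, ⟨e, parA, parB⟩, ?_, ?_, E1 id, ?_⟩⟩
  · intro x hx
    have h2 := hlt _ (hH x hx)
    by_cases h : R x
    · rw [hiR x h]; omega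
    · rw [hiL x h]; omega
  · intro j hj0 hj
    by_cases hjq : j < q
    · obtain ⟨h, hh, hb⟩ := hsurj j.toNat (by omega)
      obtain ⟨x, hx, rfl⟩ := Finset.mem_image.mp hh
      obtain ⟨y, hy, e, hr⟩ := (exR x hx).1
      refine ⟨y, hy, ?_⟩
      rw [hiR y hr, e]; omega
    · obtain ⟨h, hh, hb⟩ := hsurj (2 * q - 1 - j).toNat (by omega)
      obtain ⟨x, hx, rfl⟩ := Finset.mem_image.mp hh
      obtain ⟨y, hy, e, hr⟩ := (exR x hx).2
      refine ⟨y, hy, ?_⟩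
      rw [hiL y hr, e]; omega
  · intro x hx y hy
    simp only [hth]
    have hne : i x ≠ i y := fun h => by have := parA x hx; have := parB y hy; omega
    obtain ⟨cx, hcx, ecx⟩ := compA x hx
    obtain ⟨cy, hcy, ecy⟩ := compB y hy
    obtain ⟨r1, r2, -, -, -⟩ := rel x hx cx hcx ecx
    obtain ⟨-, -, s1, s2, -⟩ := rel cy hcy y hy ecy.symm
    rcases le_total (p x).im (p y).im with hle | hle
    · obtain ⟨o1, o2⟩ := order_core cKB cKA h0B h0A (nB y hy).1 (nB cx hcx).1 (nA x hx).2 (nA x hx).1 (nA cy hcy).1 (nB y hy).2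
        ecx ecy r1 r2 s1 s2 hle (fun h => (rel x hx y hy h.symm).2.2.2.2)
      obtain ⟨p1, p2⟩ := iord x (AD x hx) y (BD y hy) hne hle
      by_cases hr : R x
      · exact ⟨fun _ => o1 hr, fun h => absurd (p1 hr) (by omega)⟩
      · exact ⟨fun h => absurd (p2 hr) (by omega), fun _ => o2 hr⟩
    · obtain ⟨o1, o2⟩ := order_core cKA cKB h0A h0B (nA x hx).1 (nA cy hcy).1 (nB y hy).2 (nB y hy).1 (nB cx hcx).1 (nA x hx).2
        ecy ecx s1 s2 r1 r2 hle (fun h => (not_iff_comm.mp (rel x hx y hy h).2.2.2.2.symm).symm)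
      obtain ⟨p1, p2⟩ := iord y (BD y hy) x (AD x hx) hne.symm hle
      by_cases hr : R y
      · exact ⟨fun h => absurd (p1 hr) (by omega), fun _ => o1 hr⟩
      · exact ⟨fun _ => o2 hr, fun h => absurd (p2 hr) (by omega)⟩
  · intro x hx h0
    rcases (memD x).1 hx with h | h
    · exact (nA x h).2 (h0 ▸ h0B)
    · exact (nB x h).2 (h0 ▸ h0A)
  · have e : ∑ x ∈ D, Real.sin (Real.pi * (2 * i x + 1) / (2 * q)) * (p x).re =
        ∑ x ∈ D, Real.sin (Real.pi * (2 * i x + 1) / (2 * q)) * ((p x).re - M (p x).im) := by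
      have := E1 M
      simp only [mul_sub, Finset.sum_sub_distrib, this, sub_zero]
    rw [e]
    obtain ⟨x0, hx0⟩ := hDne
    obtain ⟨y, hy, -, hl⟩ := (exR x0 hx0).2
    apply ne_of_gt
    apply Finset.sum_pos'
    · intro x hx
      rw [csin x hx]
      have := spos x hx
      have hm := hM _ x hx rfl
      by_cases hr : R x
      · rw [if_pos hr]; have := hm.1 hr; apply mul_nonneg <;> linarith
      · rw [if_neg hr]; have := hm.2 hr; apply mul_nonneg_of_nonpos_of_nonpos <;> linarith
    · refine ⟨y, hy, ?_⟩
      rw [csin y hy, if_neg hl]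
      have := spos y hy
      have hm := (hM _ y hy rfl).2 hl
      apply mul_pos_of_neg_of_neg <;> linarith

end PartOd2

section PartFour
lemma translation {X : Type*} (I J : X → ℤ) (s : X → Prop) (hI : Function.Surjective I) (hJ : Function.Surjective J)
    (e e' : ℤ) (pI : ∀ x, s x → (I x + e) % 2 = 0) (pI' : ∀ x, ¬ s x → (I x + e) % 2 = 1)
    (pJ : ∀ x, s x → (J x + e') % 2 = 0) (pJ' : ∀ x, ¬ s x → (J x + e') % 2 = 1)
    (ho : ∀ x y, s x → ¬ s y → (I x < I y ↔ J x < J y)) : ∃ C : ℤ, ∀ x, J x = I x + C := by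
  have opp : ∀ x y, (I x + I y) % 2 = 1 ↔ (J x + J y) % 2 = 1 := by
    intro x y
    by_cases hx : s x <;> by_cases hy : s y
    · have := pI x hx; have := pJ x hx; have := pI y hy; have := pJ y hy; omega
    · have := pI x hx; have := pJ x hx; have := pI' y hy; have := pJ' y hy; omega
    · have := pI' x hx; have := pJ' x hx; have := pI y hy; have := pJ y hy; omega
    · have := pI' x hx; have := pJ' x hx; have := pI' y hy; have := pJ' y hy; omega
  have ord : ∀ x y, (I x + I y) % 2 = 1 → (I x < I y ↔ J x < J y) := by
    intro x y h
    have h' := (opp x y).1 h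
    by_cases hx : s x <;> by_cases hy : s y
    · have := pI x hx; have := pI y hy; omega
    · exact ho x y hx hy
    · have := ho y x hy hx; omega
    · have := pI' x hx; have := pI' y hy; omega
  have key : ∀ x y, I y = I x + 1 → J y = J x + 1 := by
    intro x y h
    by_contra hne
    obtain ⟨z, hz⟩ := hJ (J x + 1)
    obtain ⟨w, hw⟩ := hJ (J x + 2)
    have o1 := opp x y
    have o2 := opp x z
    have o3 := opp z w
    have o4 := opp w y
    have a1 := ord x y (by omega)
    have a2 := ord x z (by omega)
    have a3 := ord z w (by omega)
    have a4 := ord w y (by omega)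
    omega
  choose g hg using hI
  have hc : ∀ n : ℤ, J (g n) = n + J (g 0) := by
    intro n
    induction n using Int.induction_on with
    | zero => simp
    | succ n ih => have := key (g n) (g (n+1)) (by rw [hg, hg]); omega
    | pred n ih => have := key (g (-n-1)) (g (-n)) (by rw [hg, hg]; ring); omega
  refine ⟨J (g 0), fun x => ?_⟩
  have := key x (g (I x + 1)) (by rw [hg])
  have := hc (I x + 1)
  omega

lemma lift_order {ι : Type*} [DecidableEq ι] {A B : Finset ι} {p : ι → ℂ} {q : ℕ} {i m : ι → ℤ}
    (h : OneDir A B p q i m) (x y : ι) (hx : x ∈ A \ B) (hy : y ∈ B \ A) (s t : ℤ) :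
    i x + 2 * q * s < i y + 2 * q * t ↔
    (p x).arg + 2 * Real.pi * m x + 2 * Real.pi * s < (p y).arg + 2 * Real.pi * m y + 2 * Real.pi * t := by
  obtain ⟨o1, o2⟩ := h.ord x hx y hy
  obtain ⟨e, e1, e2⟩ := h.par
  have hxD : x ∈ symmDiff A B := by rw [Finset.mem_symmDiff]; rw [Finset.mem_sdiff] at hx; exact Or.inl hx
  have hyD : y ∈ symmDiff A B := by rw [Finset.mem_symmDiff]; rw [Finset.mem_sdiff] at hy; exact Or.inr hy
  have r1 := h.ran x hxD
  have r2 := h.ran y hyD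
  have hne : i x ≠ i y := fun h => by have := e1 x hx; have := e2 y hy; omega
  have hq := h.qpos
  have hpi := Real.pi_pos
  have hb : (p x).arg + 2 * Real.pi * m x < (p y).arg + 2 * Real.pi * m y + 2 * Real.pi ∧
      (p y).arg + 2 * Real.pi * m y < (p x).arg + 2 * Real.pi * m x + 2 * Real.pi := by
    rcases lt_or_gt_of_ne hne with h | h
    · have := o1 h; constructor <;> linarith
    · have := o2 h; constructor <;> linarith
  rcases lt_trichotomy s t with hst | rfl | hst
  · have h1 : (s:ℝ) + 1 ≤ t := by exact_mod_cast hst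
    have h2 : s + 1 ≤ t := hst
    refine ⟨fun _ => by nlinarith, fun _ => by nlinarith⟩
  · rcases lt_or_gt_of_ne hne with h | h
    · have := o1 h; exact ⟨fun _ => by linarith, fun _ => by linarith⟩
    · have := o2 h; exact ⟨fun _ => by linarith, fun _ => by linarith⟩
  · have h1 : (t:ℝ) + 1 ≤ s := by exact_mod_cast hst
    have h2 : t + 1 ≤ s := hst
    refine ⟨fun _ => by nlinarith, fun _ => by nlinarith⟩

lemma lift_surj {ι : Type*} [DecidableEq ι] {A B : Finset ι} {p : ι → ℂ} {q : ℕ} {i m : ι → ℤ}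
    (h : OneDir A B p q i m) (f : ι → ℤ) : Function.Surjective
      (fun X : {x // x ∈ symmDiff A B} × ℤ => i X.1 + 2 * q * (X.2 - f X.1)) := by
  intro n
  have hq := h.qpos
  have h1 := Int.emod_nonneg n (b := 2 * q) (by omega)
  have h2 := Int.emod_lt_of_pos n (b := 2 * q) (by omega)
  obtain ⟨x, hx, hi⟩ := h.surj _ h1 h2
  refine ⟨(⟨x, hx⟩, n / (2 * q) + f x), ?_⟩
  simp only [hi]
  have := Int.emod_add_mul_ediv n (2 * q)
  linear_combination this

lemma two_dir {ι : Type*} [DecidableEq ι] {A B : Finset ι} {p p' : ι → ℂ} {q q' : ℕ} {i m i' m' : ι → ℤ}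
    (h : OneDir A B p q i m) (h' : OneDir A B p' q' i' m') (c : ℝ) (k : ι → ℤ)
    (hk : ∀ x ∈ symmDiff A B, (p' x).arg = (p x).arg - c + 2 * Real.pi * k x) :
    q' = q ∧ ∃ C : ℤ, ∀ x ∈ symmDiff A B, ∃ s : ℤ, i' x = i x + C + 2 * q * s := by
  obtain ⟨e, e1, e2⟩ := h.par
  obtain ⟨e', e1', e2'⟩ := h'.par
  have cls : ∀ x ∈ symmDiff A B, (x ∈ A → x ∈ A \ B) ∧ (x ∉ A → x ∈ B \ A) := by
    intro x hx
    rw [Finset.mem_symmDiff] at hx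
    simp only [Finset.mem_sdiff]
    tauto
  obtain ⟨C, hC⟩ := translation (fun X : {x // x ∈ symmDiff A B} × ℤ => i X.1 + 2 * q * (X.2 - m X.1))
    (fun X : {x // x ∈ symmDiff A B} × ℤ => i' X.1 + 2 * q' * (X.2 - (m' X.1 + k X.1))) (fun X => X.1.1 ∈ A)
    (lift_surj h m) (lift_surj h' (fun x => m' x + k x)) e e'
    (fun X hX => by have := e1 X.1 ((cls X.1 X.1.2).1 hX); simp only [mul_assoc]; omega)
    (fun X hX => by have := e2 X.1 ((cls X.1 X.1.2).2 hX); simp only [mul_assoc]; omega)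
    (fun X hX => by have := e1' X.1 ((cls X.1 X.1.2).1 hX); simp only [mul_assoc]; omega)
    (fun X hX => by have := e2' X.1 ((cls X.1 X.1.2).2 hX); simp only [mul_assoc]; omega)
    (fun X Y hX hY => by
      have hx := (cls X.1 X.1.2).1 hX
      have hy := (cls Y.1 Y.1.2).2 hY
      rw [lift_order h _ _ hx hy, lift_order h' _ _ hx hy, hk _ X.1.2, hk _ Y.1.2]
      push_cast
      constructor <;> intro h <;> linarith)
  obtain ⟨x0, hx0, -⟩ := h.surj 0 le_rfl (by have := h.qpos; omega)
  have hqq : (q' : ℤ) = q := by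
    have a := hC (⟨x0, hx0⟩, 0)
    have b := hC (⟨x0, hx0⟩, 1)
    simp only [] at a b
    linarith
  refine ⟨by exact_mod_cast hqq, C, fun x hx => ⟨m' x + k x - m x, ?_⟩⟩
  have a := hC (⟨x, hx⟩, 0)
  simp only [] at a
  rw [hqq] at a
  linarith

lemma arg_shift (z w : ℂ) (hz : z ≠ 0) (hw : w ≠ 0) : ∃ k : ℤ, (z * w).arg = z.arg - (-w.arg) + 2 * Real.pi * k := by
  have := Complex.arg_mul_coe_angle hz hw
  rw [← Real.Angle.coe_add, Real.Angle.angle_eq_iff_two_pi_dvd_sub] at this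
  obtain ⟨k, hk⟩ := this
  exact ⟨k, by linarith⟩

def brk (u v : ℂ) : ℝ := u.re * v.im - u.im * v.re

lemma xdir_fourier {ι : Type*} (D : Finset ι) (q : ℕ) (hq : 0 < q) (i i' : ι → ℤ) (C : ℤ)
    (hC : ∀ x ∈ D, ∃ s : ℤ, i' x = i x + C + 2 * q * s) (Z : ι → ℂ) (u : ℂ)
    (e1 : ∑ x ∈ D, Real.sin (Real.pi * (2 * i' x + 1) / (2 * q)) * (Z x / u).im = 0)
    (e3 : ∑ x ∈ D, Real.sin (Real.pi * (2 * i' x + 1) / (2 * q)) * (Z x / u).re ≠ 0) :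
    ∃ (τ : ℂ) (l : ℝ), l ≠ 0 ∧ ‖τ‖ = 1 ∧ (τ ^ 2) ^ q = 1 ∧
      (τ * ∑ x ∈ D, Complex.exp (Complex.I * (Real.pi * (2 * i x + 1) / (2 * q) : ℝ)) * (Z x).re).im = l * u.re ∧
      (τ * ∑ x ∈ D, Complex.exp (Complex.I * (Real.pi * (2 * i x + 1) / (2 * q) : ℝ)) * (Z x).im).im = l * u.im := by
  have hq' : (q:ℝ) ≠ 0 := by positivity
  have hu : u ≠ 0 := by rintro rfl; simp at e3
  set τ := Complex.exp (Complex.I * (Real.pi * C / q : ℝ)) with hτ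
  have hs : ∀ x ∈ D, Real.sin (Real.pi * (2 * i' x + 1) / (2 * q)) =
      (τ * Complex.exp (Complex.I * (Real.pi * (2 * i x + 1) / (2 * q) : ℝ))).im := by
    intro x hx
    obtain ⟨s, hs⟩ := hC x hx
    rw [hτ, ← Complex.exp_add, ← mul_add, ← Complex.ofReal_add, mul_comm Complex.I, Complex.exp_ofReal_mul_I_im, hs]
    push_cast
    rw [← Real.sin_add_int_mul_two_pi (_ + _) s]
    congr 1
    field_simp
    ring
  have hsum : ∀ f : ι → ℝ, (τ * ∑ x ∈ D, Complex.exp (Complex.I * (Real.pi * (2 * i x + 1) / (2 * q) : ℝ)) * (f x)).im =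
      ∑ x ∈ D, Real.sin (Real.pi * (2 * i' x + 1) / (2 * q)) * f x := by
    intro f
    rw [Finset.mul_sum, Complex.im_sum]
    apply Finset.sum_congr rfl
    intro x hx
    rw [hs x hx, ← mul_assoc, Complex.im_mul_ofReal]
  have hN : Complex.normSq u ≠ 0 := by simpa using hu
  have hN' : Complex.normSq u = u.re * u.re + u.im * u.im := Complex.normSq_apply u
  set a := ∑ x ∈ D, Real.sin (Real.pi * (2 * i' x + 1) / (2 * q)) * (Z x).re with ha
  set b := ∑ x ∈ D, Real.sin (Real.pi * (2 * i' x + 1) / (2 * q)) * (Z x).im with hb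
  have f1 : ∑ x ∈ D, Real.sin (Real.pi * (2 * i' x + 1) / (2 * q)) * (Z x / u).im = (b * u.re - a * u.im) / Complex.normSq u := by
    rw [ha, hb, Finset.sum_mul, Finset.sum_mul, ← Finset.sum_sub_distrib, Finset.sum_div]
    apply Finset.sum_congr rfl
    intro x hx
    rw [Complex.div_im]; ring
  have f3 : ∑ x ∈ D, Real.sin (Real.pi * (2 * i' x + 1) / (2 * q)) * (Z x / u).re = (a * u.re + b * u.im) / Complex.normSq u := by
    rw [ha, hb, Finset.sum_mul, Finset.sum_mul, ← Finset.sum_add_distrib, Finset.sum_div]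
    apply Finset.sum_congr rfl
    intro x hx
    rw [Complex.div_re]; ring
  rw [f1, div_eq_zero_iff] at e1
  have e1' := e1.resolve_right hN
  rw [f3] at e3
  refine ⟨τ, (a * u.re + b * u.im) / Complex.normSq u, e3, ?_, ?_, ?_, ?_⟩
  · rw [hτ, mul_comm]; exact Complex.norm_exp_ofReal_mul_I _
  · rw [← pow_mul, hτ, ← Complex.exp_nat_mul, Complex.exp_eq_one_iff]
    refine ⟨C, ?_⟩
    have : (q:ℂ) ≠ 0 := by exact_mod_cast hq.ne'
    push_cast
    field_simp
  · rw [hsum (fun x => (Z x).re), div_mul_eq_mul_div, eq_div_iff hN, hN']; linear_combination -u.im * e1'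
  · rw [hsum (fun x => (Z x).im), div_mul_eq_mul_div, eq_div_iff hN, hN']; linear_combination u.re * e1'

theorem cross_ratio_good {ι : Type*} [DecidableEq ι] (A B : Finset ι) (Z : ι → ℂ) (u : Fin 4 → ℂ)
    (hu : ∀ a b, a ≠ b → brk (u a) (u b) ≠ 0) (hOne : ∀ a, ∃ q i m, OneDir A B (fun x => Z x / u a) q i m)
    (r : ℚ) (hr : brk (u 0) (u 2) * brk (u 1) (u 3) = r * (brk (u 0) (u 3) * brk (u 1) (u 2))) : GoodAbs |r| := by
  have hu0 : ∀ a, u a ≠ 0 := by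
    intro a h
    have : brk (u a) (u (a+1)) ≠ 0 := hu _ _ (by fin_cases a <;> decide)
    rw [h] at this
    simp [brk] at this
  choose q i m h using hOne
  have hZ : ∀ x ∈ symmDiff A B, Z x ≠ 0 := fun x hx h0 => (h 0).nz x hx (by simp [h0])
  have h2 : ∀ a, q a = q 0 ∧ ∃ C : ℤ, ∀ x ∈ symmDiff A B, ∃ s : ℤ, i a x = i 0 x + C + 2 * (q 0) * s := by
    intro a
    have := fun x : ι => fun hx : x ∈ symmDiff A B => arg_shift (Z x / u 0) (u 0 / u a) (div_ne_zero (hZ x hx) (hu0 0)) (div_ne_zero (hu0 0) (hu0 a))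
    choose! k hk using this
    refine two_dir (h 0) (h a) (-(u 0 / u a).arg) k (fun x hx => ?_)
    rw [← hk x hx]
    congr 1
    have := hu0 0
    have := hu0 a
    field_simp
  have h3 := fun a => xdir_fourier (symmDiff A B) (q 0) (h 0).qpos (i 0) (i a) (h2 a).2.choose (h2 a).2.choose_spec Z (u a)
    (by have := (h a).e1; rwa [(h2 a).1] at this) (by have := (h a).e3; rwa [(h2 a).1] at this)
  choose τ l hl hτ hτq ha hb using h3
  set a := ∑ x ∈ symmDiff A B, Complex.exp (Complex.I * (Real.pi * (2 * i 0 x + 1) / (2 * q 0) : ℝ)) * (Z x).re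
  set b := ∑ x ∈ symmDiff A B, Complex.exp (Complex.I * (Real.pi * (2 * i 0 x + 1) / (2 * q 0) : ℝ)) * (Z x).im
  let conj := starRingEnd ℂ
  set Δ : ℂ := a * conj b - b * conj a with hΔ
  have im_eq : ∀ z : ℂ, 2 * Complex.I * (z.im : ℂ) = z - conj z := by
    intro z; rw [Complex.sub_conj]; push_cast; ring
  have hττ : ∀ s, τ s * conj (τ s) = 1 := by
    intro s; rw [Complex.mul_conj, Complex.normSq_eq_norm_sq, hτ]; simp
  have main : ∀ s t, (brk (u s) (u t) : ℂ) * ((2 * l s * τ s) * (2 * l t * τ t)) = (τ s ^ 2 - τ t ^ 2) * Δ := by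
    intro s t
    have a1 := im_eq (τ s * a)
    have a2 := im_eq (τ t * a)
    have a3 := im_eq (τ s * b)
    have a4 := im_eq (τ t * b)
    rw [ha, map_mul] at a1 a2
    rw [hb, map_mul] at a3 a4
    have c1 := hττ s
    have c2 := hττ t
    push_cast at a1 a2 a3 a4
    have hI := Complex.I_mul_I
    have : -4 * ((l s : ℂ) * l t * brk (u s) (u t)) = (conj (τ s) * τ t - τ s * conj (τ t)) * Δ := by
      have : -4 * ((l s : ℂ) * l t * brk (u s) (u t)) =
        (2 * Complex.I * (l s * (u s).re)) * (2 * Complex.I * (l t * (u t).im)) - (2 * Complex.I * (l s * (u s).im)) * (2 * Complex.I * (l t * (u t).re)) := by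
        simp only [brk]; push_cast
        linear_combination (-4 * ((l s : ℂ) * l t * ((u s).re * (u t).im - (u s).im * (u t).re))) * hI
      rw [this, a1, a2, a3, a4, hΔ]; ring
    calc (brk (u s) (u t) : ℂ) * ((2 * l s * τ s) * (2 * l t * τ t)) = -(-4 * ((l s : ℂ) * l t * brk (u s) (u t))) * (τ s * τ t) := by ring
      _ = -((conj (τ s) * τ t - τ s * conj (τ t)) * Δ) * (τ s * τ t) := by rw [this]
      _ = (τ s ^ 2 * (τ t * conj (τ t)) - τ t ^ 2 * (τ s * conj (τ s))) * Δ := by ring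
      _ = _ := by rw [c1, c2]; ring
  have hc : ∀ s, (2 * l s * τ s : ℂ) ≠ 0 := by
    intro s
    have : τ s ≠ 0 := by intro h; have := hτ s; rw [h] at this; simp at this
    have := hl s
    simp; tauto
  have hbr : ∀ s t, s ≠ t → (τ s ^ 2 - τ t ^ 2) * Δ ≠ 0 := by
    intro s t hst
    rw [← main s t]
    have := hu s t hst
    exact mul_ne_zero (by exact_mod_cast this) (mul_ne_zero (hc s) (hc t))
  have hΔ0 : Δ ≠ 0 := fun h0 => hbr 0 1 (by decide) (by rw [h0, mul_zero])
  refine good_cr (q 0) (h 0).qpos (fun s => τ s ^ 2) hτq ?_ r ?_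
  · intro s t hst
    by_contra hne
    apply hbr s t hne
    simp only [] at hst
    rw [hst]; ring
  · have hrC : (brk (u 0) (u 2) : ℂ) * brk (u 1) (u 3) = r * (brk (u 0) (u 3) * brk (u 1) (u 2)) := by exact_mod_cast hr
    have m1 := main 0 2
    have m2 := main 1 3
    have m3 := main 0 3
    have m4 := main 1 2
    have hcc := mul_ne_zero hΔ0 hΔ0
    apply mul_right_cancel₀ hcc
    calc (τ 0 ^ 2 - τ 2 ^ 2) * (τ 1 ^ 2 - τ 3 ^ 2) * (Δ * Δ) = ((τ 0 ^ 2 - τ 2 ^ 2) * Δ) * ((τ 1 ^ 2 - τ 3 ^ 2) * Δ) := by ring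
      _ = r * (((τ 0 ^ 2 - τ 3 ^ 2) * Δ) * ((τ 1 ^ 2 - τ 2 ^ 2) * Δ)) := by
        rw [← m1, ← m2, ← m3, ← m4]
        linear_combination ((2 * l 0 * τ 0) * (2 * l 2 * τ 2) * (2 * l 1 * τ 1) * (2 * l 3 * τ 3)) * hrC
      _ = _ := by ring

end PartFour

section PartPlan
lemma affine_hull (g : ℂ →ᵃ[ℝ] ℂ) {S : Set ℂ} {z : ℂ} (hz : z ∈ convexHull ℝ S) : g z ∈ convexHull ℝ (g '' S) := by
  rw [← AffineMap.image_convexHull]; exact ⟨z, hz, rfl⟩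

theorem planar {ι : Type*} [DecidableEq ι] (A B : Finset ι) (p : ι → ℂ)
    (hA : ∀ x ∈ A, x ∉ B → p x ∉ convexHull ℝ (p '' (B : Set ι)))
    (hB : ∀ x ∈ B, x ∉ A → p x ∉ convexHull ℝ (p '' (A : Set ι))) (hne : A ≠ B) (u : Fin 4 → ℂ)
    (hu : ∀ a b, a ≠ b → brk (u a) (u b) ≠ 0)
    (hX : ∀ a, ∀ h : ℝ, (A.filter (fun x => (p x / u a).im = h)).card = (B.filter (fun x => (p x / u a).im = h)).card)
    (r : ℚ) (hr : brk (u 0) (u 2) * brk (u 1) (u 3) = r * (brk (u 0) (u 3) * brk (u 1) (u 2))) : GoodAbs |r| := by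
  have hu0 : ∀ a, u a ≠ 0 := by
    intro a h
    have : brk (u a) (u (a+1)) ≠ 0 := hu _ _ (by fin_cases a <;> decide)
    rw [h] at this
    simp [brk] at this
  have hcard : A.card = B.card := by
    have := sum_height A B (fun x => (p x / u 0).im) (hX 0) (fun _ => (1:ℕ))
    simpa using this
  have hApos : 0 < A.card := by
    rw [Finset.card_pos, Finset.nonempty_iff_ne_empty]
    rintro rfl
    apply hne
    rw [Finset.card_empty] at hcard
    exact (Finset.card_eq_zero.mp hcard.symm).symm
  have hsum : ∑ x ∈ A, p x = ∑ x ∈ B, p x := by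
    have h1 : ∀ a, ((∑ x ∈ A, p x - ∑ x ∈ B, p x) / u a).im = 0 := by
      intro a
      rw [sub_div, Finset.sum_div, Finset.sum_div, Complex.sub_im, Complex.im_sum, Complex.im_sum, sub_eq_zero]
      exact sum_height A B (fun x => (p x / u a).im) (hX a) id
    set s := ∑ x ∈ A, p x - ∑ x ∈ B, p x with hs
    have h2 : ∀ a, s.im * (u a).re - s.re * (u a).im = 0 := by
      intro a
      have hN : Complex.normSq (u a) ≠ 0 := by simpa using hu0 a
      have := h1 a
      rw [Complex.div_im] at this
      field_simp at this
      linarith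
    have hb := hu 0 1 (by decide)
    have a0 := h2 0
    have a1 := h2 1
    unfold brk at hb
    have : s = 0 := by
      apply Complex.ext
      · apply mul_right_cancel₀ hb; rw [Complex.zero_re, zero_mul]
        linear_combination (u 1).re * a0 - (u 0).re * a1
      · apply mul_right_cancel₀ hb; rw [Complex.zero_im, zero_mul]
        linear_combination (u 1).im * a0 - (u 0).im * a1
    rwa [hs, sub_eq_zero] at this
  have cen : ∀ C : Finset ι, 0 < C.card → ((C.card : ℝ)⁻¹) • (∑ x ∈ C, p x) ∈ convexHull ℝ (p '' (C : Set ι)) := by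
    intro C hC
    have hC' : (C.card : ℝ) ≠ 0 := by positivity
    rw [Finset.smul_sum]
    apply (convex_convexHull ℝ (p '' (C : Set ι))).sum_mem
    · intro x hx; positivity
    · rw [Finset.sum_const, nsmul_eq_mul]; field_simp
    · intro x hx; exact subset_convexHull _ _ ⟨x, hx, rfl⟩
  have OA := cen A hApos
  have OB := cen B (hcard ▸ hApos)
  rw [← hcard, ← hsum] at OB
  set O := ((A.card : ℝ)⁻¹) • (∑ x ∈ A, p x) with hO
  refine cross_ratio_good A B (fun x => p x - O) u hu ?_ r hr
  intro a
  have hua := hu0 a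
  let g : ℂ →ᵃ[ℝ] ℂ := (LinearMap.mulRight ℝ (u a)).toAffineMap + AffineMap.const ℝ ℂ O
  let f : ℂ →ᵃ[ℝ] ℂ := (LinearMap.mulRight ℝ (u a)⁻¹).toAffineMap + AffineMap.const ℝ ℂ (-(O / u a))
  have hg : ∀ z, g z = z * u a + O := fun z => by simp [g]
  have hf : ∀ z, f z = (z - O) / u a := fun z => by simp [f]; ring
  have hgf : ∀ z, g (f z) = z := fun z => by rw [hg, hf]; field_simp; ring
  have hfp : (fun x => (p x - O) / u a) = f ∘ p := by funext x; simp [hf]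
  have nc : ∀ (C : Finset ι) (z : ℂ), z ∉ convexHull ℝ (p '' (C : Set ι)) → f z ∉ convexHull ℝ ((f ∘ p) '' (C : Set ι)) := by
    intro C z hz hcon
    apply hz
    have := affine_hull g hcon
    rw [hgf, ← Set.image_comp] at this
    convert this using 3
    simp [hgf]
  rw [hfp]
  apply one_dir A B (f ∘ p)
  · intro h
    have := hX a (h + (O / u a).im)
    have e : ∀ x, ((f ∘ p) x).im = h ↔ (p x / u a).im = h + (O / u a).im := by
      intro x
      simp only [Function.comp, hf, sub_div, Complex.sub_im]
      constructor <;> intro h <;> linarith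
    simp only [e]
    exact this
  · intro x hx hx'; exact nc B (p x) (hA x hx hx')
  · intro x hx hx'; exact nc A (p x) (hB x hx hx')
  · have := affine_hull f OA
    rw [hf, sub_self, zero_div, ← Set.image_comp] at this
    exact this
  · have := affine_hull f OB
    rw [hf, sub_self, zero_div, ← Set.image_comp] at this
    exact this
  · exact hne

def ratL : List ℚ := [1, 2, 3, 4, 1/2, 1/3, 1/4, 3/2, 2/3, 3/4, 4/3, -1, -2, -3, -4, -1/2, -1/3, -1/4, -3/2, -2/3, -3/4, -4/3]

lemma mem_ratL (t : ℚ) (h : GoodAbs |t|) : t ∈ ratL := by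
  unfold GoodAbs at h
  unfold ratL
  rcases abs_choice t with e | e <;> rw [e] at h
  · simp only [List.mem_cons]; tauto
  · rcases h with h | h | h | h | h | h | h | h | h | h | h <;> (rw [neg_eq_iff_eq_neg] at h; rw [h]; norm_num)

def okp (a b : ℚ) : Prop := a ≠ b ∧ GoodAbs |a / b| ∧ GoodAbs |1 - a / b|
/-- Integer version of `GoodAbs` for the ratio `m / n`. -/
def goodz (m n : ℕ) : Bool := Nat.beq m n || Nat.beq m (2 * n) || Nat.beq m (3 * n) || Nat.beq m (4 * n) ||
  Nat.beq (2 * m) n || Nat.beq (3 * m) n || Nat.beq (4 * m) n || Nat.beq (2 * m) (3 * n) ||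
  Nat.beq (3 * m) (2 * n) || Nat.beq (4 * m) (3 * n) || Nat.beq (3 * m) (4 * n)

/-- Integer version of `okp`. -/
def okz (a b : ℤ) : Bool := !(decide (a = b)) && (goodz a.natAbs b.natAbs && goodz (b - a).natAbs b.natAbs)

lemma goodz_of (x y : ℤ) (hy : y ≠ 0) (h : GoodAbs |(x : ℚ) / y|) : goodz x.natAbs y.natAbs = true := by
  have hy' : |(y : ℚ)| ≠ 0 := by simpa using hy
  have hx2 : |(x : ℚ)| = (x.natAbs : ℚ) := by rw [Nat.cast_natAbs]; simp
  have hy2 : |(y : ℚ)| = (y.natAbs : ℚ) := by rw [Nat.cast_natAbs]; simp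
  unfold GoodAbs at h
  rw [abs_div] at h
  rw [hx2, hy2] at h
  rw [hy2] at hy'
  unfold goodz
  simp only [Bool.or_eq_true, Nat.beq_eq]
  generalize x.natAbs = m at *
  generalize y.natAbs = n at *
  rcases h with h | h | h | h | h | h | h | h | h | h | h <;> rw [div_eq_iff hy'] at h
  · have : m = n := by qify; linarith
    omega
  · have : m = 2 * n := by qify; linarith
    omega
  · have : m = 3 * n := by qify; linarith
    omega
  · have : m = 4 * n := by qify; linarith
    omega
  · have : 2 * m = n := by qify; linarith
    omega
  · have : 3 * m = n := by qify; linarith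
    omega
  · have : 4 * m = n := by qify; linarith
    omega
  · have : 2 * m = 3 * n := by qify; linarith
    omega
  · have : 3 * m = 2 * n := by qify; linarith
    omega
  · have : 4 * m = 3 * n := by qify; linarith
    omega
  · have : 3 * m = 4 * n := by qify; linarith
    omega

lemma okz_of (x y : ℤ) (hy : y ≠ 0) (h : okp ((x : ℚ) / 12) ((y : ℚ) / 12)) : okz x y = true := by
  obtain ⟨h1, h2, h3⟩ := h
  have hy' : (y : ℚ) ≠ 0 := by exact_mod_cast hy
  rw [div_div_div_cancel_right₀ (by norm_num)] at h2 h3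
  have e : (1 : ℚ) - x / y = ((y - x : ℤ) : ℚ) / y := by push_cast; field_simp
  rw [e] at h3
  unfold okz
  rw [goodz_of x y hy h2, goodz_of _ y hy h3]
  have : x ≠ y := fun e => h1 (by rw [e])
  simp [this]

/-- The possible values, multiplied by `12`. -/
def intL : List ℤ := [12, 24, 36, 48, 6, 4, 3, 18, 8, 9, 16, -12, -24, -36, -48, -6, -4, -3, -18, -8, -9, -16]

lemma mem_intL (t : ℚ) (h : t ∈ ratL) : ∃ a ∈ intL, a ≠ 0 ∧ t = (a : ℚ) / 12 := by
  have h2 : (12 * t).num ∈ intL ∧ (12 * t).num ≠ 0 ∧ 12 * t = (12 * t).num := by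
    unfold ratL at h
    simp only [List.mem_cons, List.not_mem_nil, or_false] at h
    rcases h with h | h | h | h | h | h | h | h | h | h | h | h | h | h | h | h | h | h | h | h | h | h <;>
      (rw [h]; norm_num [intL])
  exact ⟨_, h2.1, h2.2.1, by rw [← h2.2.2]; ring⟩

/-- The values compatible with `12`. -/
def intL2 : List ℤ := [Int.ofNat 24, Int.ofNat 36, Int.ofNat 48, Int.ofNat 6, Int.ofNat 4, Int.ofNat 3, Int.ofNat 18, Int.ofNat 8, Int.ofNat 9, Int.ofNat 16, Int.negSucc 11, Int.negSucc 23, Int.negSucc 35, Int.negSucc 5, Int.negSucc 3]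

lemma intL2_eq : intL.filter (fun a => okz a 12) = intL2 := by
  decide

set_option maxRecDepth 100000 in
lemma int_check : (intL2.all fun a => intL2.all fun b => !(okz a b) || intL2.all fun c => !(okz a c && okz b c) ||
    intL2.all fun e => !(okz a e && (okz b e && okz c e))) = true := by
  decide +kernel

lemma rat_check : ∀ a ∈ ratL, okp a 1 → ∀ b ∈ ratL, okp b 1 → okp a b → ∀ c ∈ ratL, okp c 1 → okp a c → okp b c →
    ∀ e ∈ ratL, okp e 1 → okp a e → okp b e → okp c e → False := by
  intro a ha a1 b hb b1 ab c hc c1 ac bc e he e1 ae be ce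
  obtain ⟨a, ha', a0, rfl⟩ := mem_intL a ha
  obtain ⟨b, hb', b0, rfl⟩ := mem_intL b hb
  obtain ⟨c, hc', c0, rfl⟩ := mem_intL c hc
  obtain ⟨e, he', e0, rfl⟩ := mem_intL e he
  have one : ∀ x : ℤ, x ∈ intL → okp ((x : ℚ) / 12) 1 → x ∈ intL2 := by
    intro x hx h
    rw [← intL2_eq]
    refine List.mem_filter.mpr ⟨hx, okz_of x 12 (by norm_num) ?_⟩
    rw [show (((12 : ℤ) : ℚ) / 12) = 1 by norm_num]
    exact h
  have H := int_check
  rw [List.all_eq_true] at H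
  have H := H a (one a ha' a1)
  rw [List.all_eq_true] at H
  have H := H b (one b hb' b1)
  rw [okz_of a b b0 ab, Bool.not_true, Bool.false_or, List.all_eq_true] at H
  have H := H c (one c hc' c1)
  rw [okz_of a c c0 ac, okz_of b c c0 bc, Bool.and_true, Bool.not_true, Bool.false_or, List.all_eq_true] at H
  have H := H e (one e he' e1)
  rw [okz_of a e e0 ae, okz_of b e e0 be, okz_of c e e0 ce] at H
  simp at H

lemma no_five (s : Fin 5 → ℚ) (hs : ∀ j, s j ≠ 0) (hinj : ∀ j k, j ≠ k → s j ≠ s k)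
    (h : ∀ j k, j ≠ k → GoodAbs |s j / s k| ∧ GoodAbs |1 - s j / s k|) : False := by
  have k1 : ∀ j, j ≠ 0 → (s j / s 0) ∈ ratL ∧ okp (s j / s 0) 1 := by
    intro j hj
    refine ⟨mem_ratL _ (h j 0 hj).1, ?_, ?_⟩
    · intro he; rw [div_eq_one_iff_eq (hs 0)] at he; exact hinj j 0 hj he
    · rw [div_one]; exact h j 0 hj
  have k2 : ∀ j k, j ≠ k → okp (s j / s 0) (s k / s 0) := by
    intro j k hjk
    refine ⟨?_, ?_⟩
    · intro he; exact hinj j k hjk (by have := hs 0; field_simp at he; exact he)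
    · rw [div_div_div_cancel_right₀ (hs 0)]; exact h j k hjk
  exact rat_check _ (k1 1 (by decide)).1 (k1 1 (by decide)).2 _ (k1 2 (by decide)).1 (k1 2 (by decide)).2 (k2 1 2 (by decide))
    _ (k1 3 (by decide)).1 (k1 3 (by decide)).2 (k2 1 3 (by decide)) (k2 2 3 (by decide))
    _ (k1 4 (by decide)).1 (k1 4 (by decide)).2 (k2 1 4 (by decide)) (k2 2 4 (by decide)) (k2 3 4 (by decide))

/-- Planar uniqueness for at least seven rational directions. -/
theorem planar7 {ι : Type*} [DecidableEq ι] (A B : Finset ι) (p : ι → ℂ)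
    (hA : ∀ x ∈ A, x ∉ B → p x ∉ convexHull ℝ (p '' (B : Set ι)))
    (hB : ∀ x ∈ B, x ∉ A → p x ∉ convexHull ℝ (p '' (A : Set ι))) (u : Fin 5 → ℂ)
    (x y : Fin 5 → ℚ) (hxy : ∀ j, u j = ⟨x j, y j⟩) (hx : ∀ j, x j ≠ 0) (hy : ∀ j, y j ≠ 0)
    (hu : ∀ a b, a ≠ b → brk (u a) (u b) ≠ 0)
    (hX0 : ∀ h : ℝ, (A.filter (fun x => (p x / 1).im = h)).card = (B.filter (fun x => (p x / 1).im = h)).card)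
    (hX1 : ∀ h : ℝ, (A.filter (fun x => (p x / Complex.I).im = h)).card = (B.filter (fun x => (p x / Complex.I).im = h)).card)
    (hX : ∀ a, ∀ h : ℝ, (A.filter (fun x => (p x / u a).im = h)).card = (B.filter (fun x => (p x / u a).im = h)).card) :
    A = B := by
  by_contra hne
  have hbr : ∀ j k, brk (u j) (u k) = x j * y k - y j * x k := fun j k => by rw [hxy, hxy]; rfl
  have hb0 : ∀ j, brk 1 (u j) = y j := fun j => by rw [hxy]; simp [brk]
  have hb0' : ∀ j, brk (u j) 1 = -y j := fun j => by rw [hxy]; simp [brk]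
  have hb1 : ∀ j, brk Complex.I (u j) = -x j := fun j => by rw [hxy]; simp [brk]
  have hb1' : ∀ j, brk (u j) Complex.I = x j := fun j => by rw [hxy]; simp [brk]
  have hb01 : brk 1 Complex.I = 1 := by simp [brk]
  have hb10 : brk Complex.I 1 = -1 := by simp [brk]
  have hxR : ∀ j, (x j : ℝ) ≠ 0 := fun j => by exact_mod_cast hx j
  have hyR : ∀ j, (y j : ℝ) ≠ 0 := fun j => by exact_mod_cast hy j
  refine no_five (fun j => y j / x j) (fun j => div_ne_zero (hy j) (hx j)) (fun j k hjk => ?_) (fun j k hjk => ⟨?_, ?_⟩)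
  · intro he
    rw [div_eq_div_iff (hx j) (hx k)] at he
    apply hu j k hjk
    rw [hbr, sub_eq_zero]
    exact_mod_cast (by linarith : x j * y k = y j * x k)
  · refine planar A B p hA hB hne ![1, Complex.I, u j, u k] ?_ ?_ _ ?_
    · intro a b hab
      have h1 := hu j k hjk
      have h2 := hu k j hjk.symm
      fin_cases a <;> fin_cases b <;> first | exact absurd rfl hab | skip
      all_goals simp only [Fin.mk_zero, Fin.mk_one, Fin.reduceFinMk, Fin.isValue, Matrix.cons_val, hb0, hb1, hb0', hb1', hb01, hb10, ne_eq, neg_eq_zero, one_ne_zero, not_false_iff]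
      all_goals first | exact h1 | exact h2 | exact hxR _ | exact hyR _
    · intro a
      fin_cases a
      exacts [hX0, hX1, hX j, hX k]
    · simp only [Fin.isValue, Matrix.cons_val, hb0, hb1]
      have := hxR j; have := hxR k; have := hyR j; have := hyR k
      push_cast
      field_simp
  · refine planar A B p hA hB hne ![1, u j, Complex.I, u k] ?_ ?_ _ ?_
    · intro a b hab
      have h1 := hu j k hjk
      have h2 := hu k j hjk.symm
      fin_cases a <;> fin_cases b <;> first | exact absurd rfl hab | skip
      all_goals simp only [Fin.mk_zero, Fin.mk_one, Fin.reduceFinMk, Fin.isValue, Matrix.cons_val, hb0, hb1, hb0', hb1', hb01, hb10, ne_eq, neg_eq_zero, one_ne_zero, not_false_iff]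
      all_goals first | exact h1 | exact h2 | exact hxR _ | exact hyR _
    · intro a
      fin_cases a
      exacts [hX0, hX j, hX1, hX k]
    · simp only [Fin.isValue, Matrix.cons_val, hb0, hb1', hb01, hbr]
      have := hxR j; have := hxR k; have := hyR j; have := hyR k
      push_cast
      field_simp

theorem planar4 {ι : Type*} [DecidableEq ι] (A B : Finset ι) (p : ι → ℂ)
    (hA : ∀ x ∈ A, x ∉ B → p x ∉ convexHull ℝ (p '' (B : Set ι)))
    (hB : ∀ x ∈ B, x ∉ A → p x ∉ convexHull ℝ (p '' (A : Set ι))) 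
    (hX : ∀ a : Fin 4, ∀ h : ℝ, (A.filter (fun x => (p x / (![1, Complex.I, ⟨1, 1⟩, ⟨1, 5⟩] : Fin 4 → ℂ) a).im = h)).card =
      (B.filter (fun x => (p x / (![1, Complex.I, ⟨1, 1⟩, ⟨1, 5⟩] : Fin 4 → ℂ) a).im = h)).card) :
    A = B := by
  by_contra hne
  have : GoodAbs |1/5| := by
    refine planar A B p hA hB hne _ ?_ hX _ ?_
    · intro a b hab
      fin_cases a <;> fin_cases b <;> first | exact absurd rfl hab | (simp [brk]; try norm_num)
    · simp [brk]
  rw [abs_of_pos (by norm_num)] at this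
  unfold GoodAbs at this
  norm_num at this

end PartPlan

section PartCore
lemma embed_inj : Function.Injective (embed : (Fin d → ℤ) → (Fin d → ℝ)) := by
  intro x y h
  funext i
  have := congrFun h i
  simpa [embed] using this

/-- The X-ray difference in a single direction. -/
noncomputable def dlt (S : Submodule ℝ (Fin d → ℝ)) (F₁ F₂ : Finset (Fin d → ℤ)) : ℕ :=
  ∑ᶠ T : (Fin d → ℝ) ⧸ S,
    ((((embed '' (F₁ : Set (Fin d → ℤ))) ∩ fiber S T).ncard : ℤ) - (((embed '' (F₂ : Set (Fin d → ℤ))) ∩ fiber S T).ncard : ℤ)).natAbs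

lemma fiber_card (S : Submodule ℝ (Fin d → ℝ)) (F : Finset (Fin d → ℤ)) (T : (Fin d → ℝ) ⧸ S) 
    (R : (Fin d → ℤ) → Prop) [DecidablePred R]
    (hR : ∀ x ∈ F, R x ↔ (Submodule.Quotient.mk (embed x) : (Fin d → ℝ) ⧸ S) = T) :
    ((embed '' (F : Set (Fin d → ℤ))) ∩ fiber S T).ncard = (F.filter R).card := by
  have : (embed '' (F : Set (Fin d → ℤ))) ∩ fiber S T = embed '' ((F.filter R : Finset (Fin d → ℤ)) : Set (Fin d → ℤ)) := by
    ext y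
    constructor
    · rintro ⟨⟨x, hx, rfl⟩, hy⟩
      exact ⟨x, by simp only [Finset.coe_filter]; exact ⟨hx, (hR x hx).2 hy⟩, rfl⟩
    · rintro ⟨x, hx, rfl⟩
      simp only [Finset.coe_filter] at hx
      exact ⟨⟨x, hx.1, rfl⟩, (hR x hx.1).1 hx.2⟩
  rw [this, Set.ncard_image_of_injective _ embed_inj, Set.ncard_coe_finset]

lemma exists_of_ne (S : Submodule ℝ (Fin d → ℝ)) (F₁ F₂ : Finset (Fin d → ℤ)) (T : (Fin d → ℝ) ⧸ S)
    (h : ((embed '' (F₁ : Set (Fin d → ℤ))) ∩ fiber S T).ncard ≠ ((embed '' (F₂ : Set (Fin d → ℤ))) ∩ fiber S T).ncard) :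
    ∃ x, x ∈ F₁ ∪ F₂ ∧ (Submodule.Quotient.mk (embed x) : (Fin d → ℝ) ⧸ S) = T := by
  classical
  rw [fiber_card S F₁ T (fun x => (Submodule.Quotient.mk (embed x) : (Fin d → ℝ) ⧸ S) = T) (fun _ _ => Iff.rfl),
    fiber_card S F₂ T (fun x => (Submodule.Quotient.mk (embed x) : (Fin d → ℝ) ⧸ S) = T) (fun _ _ => Iff.rfl)] at h
  by_contra hcon
  push Not at hcon
  apply h
  rw [Finset.filter_false_of_mem (fun x hx => hcon x (Finset.mem_union_left _ hx)),
    Finset.filter_false_of_mem (fun x hx => hcon x (Finset.mem_union_right _ hx))]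

lemma dlt_eq (S : Submodule ℝ (Fin d → ℝ)) (F₁ F₂ : Finset (Fin d → ℤ)) (𝒯 : Finset ((Fin d → ℝ) ⧸ S))
    (h : ∀ x ∈ F₁ ∪ F₂, (Submodule.Quotient.mk (embed x) : (Fin d → ℝ) ⧸ S) ∈ 𝒯) :
    dlt S F₁ F₂ = ∑ T ∈ 𝒯, ((((embed '' (F₁ : Set (Fin d → ℤ))) ∩ fiber S T).ncard : ℤ) - (((embed '' (F₂ : Set (Fin d → ℤ))) ∩ fiber S T).ncard : ℤ)).natAbs := by
  unfold dlt
  apply finsum_eq_sum_of_support_subset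
  intro T hT
  rw [Function.mem_support] at hT
  obtain ⟨x, hx, rfl⟩ := exists_of_ne S F₁ F₂ T (by
    intro he; apply hT; rw [he]; simp)
  exact h x hx

lemma dlt_zero (S : Submodule ℝ (Fin d → ℝ)) (F₁ F₂ : Finset (Fin d → ℤ)) (h : dlt S F₁ F₂ = 0) (T : (Fin d → ℝ) ⧸ S) :
    ((embed '' (F₁ : Set (Fin d → ℤ))) ∩ fiber S T).ncard = ((embed '' (F₂ : Set (Fin d → ℤ))) ∩ fiber S T).ncard := by
  classical
  by_contra hne
  obtain ⟨x, hx, rfl⟩ := exists_of_ne S F₁ F₂ T hne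
  rw [dlt_eq S F₁ F₂ ((F₁ ∪ F₂).image (fun x => Submodule.Quotient.mk (embed x))) (fun x hx => Finset.mem_image_of_mem _ hx), Finset.sum_eq_zero_iff] at h
  have := h _ (Finset.mem_image_of_mem _ hx)
  omega

lemma dlt_two (S : Submodule ℝ (Fin d → ℝ)) (F₁ F₂ : Finset (Fin d → ℤ)) (hc : F₁.card = F₂.card) (h : dlt S F₁ F₂ ≠ 0) :
    2 ≤ dlt S F₁ F₂ := by
  classical
  suffices h2 : (2:ℤ) ∣ dlt S F₁ F₂ by omega
  rw [dlt_eq S F₁ F₂ ((F₁ ∪ F₂).image (fun x => Submodule.Quotient.mk (embed x))) (fun x hx => Finset.mem_image_of_mem _ hx)]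
  set 𝒯 := (F₁ ∪ F₂).image (fun x => (Submodule.Quotient.mk (embed x) : (Fin d → ℝ) ⧸ S)) with h𝒯
  have hs : ∀ F : Finset (Fin d → ℤ), F ⊆ F₁ ∪ F₂ → ∑ T ∈ 𝒯, ((embed '' (F : Set (Fin d → ℤ))) ∩ fiber S T).ncard = F.card := by
    intro F hF
    rw [Finset.card_eq_sum_card_fiberwise (f := fun x => (Submodule.Quotient.mk (embed x) : (Fin d → ℝ) ⧸ S)) (t := 𝒯)
      (fun x hx => Finset.mem_image_of_mem _ (hF hx))]
    apply Finset.sum_congr rfl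
    intro T hT
    exact fiber_card S F T _ (fun _ _ => Iff.rfl)
  have h1 : ∑ T ∈ 𝒯, (((embed '' (F₁ : Set (Fin d → ℤ))) ∩ fiber S T).ncard : ℤ) = F₁.card := by
    exact_mod_cast hs F₁ Finset.subset_union_left
  have h2 : ∑ T ∈ 𝒯, (((embed '' (F₂ : Set (Fin d → ℤ))) ∩ fiber S T).ncard : ℤ) = F₂.card := by
    exact_mod_cast hs F₂ Finset.subset_union_right
  have h3 : ∑ T ∈ 𝒯, ((((embed '' (F₁ : Set (Fin d → ℤ))) ∩ fiber S T).ncard : ℤ) - (((embed '' (F₂ : Set (Fin d → ℤ))) ∩ fiber S T).ncard : ℤ)) = 0 := by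
    rw [Finset.sum_sub_distrib, h1, h2, hc, sub_self]
  rw [← add_zero ((_ : ℕ) : ℤ), ← h3]
  push_cast
  rw [← Finset.sum_add_distrib]
  apply Finset.dvd_sum
  intro T _
  rcases abs_choice ((((embed '' (F₁ : Set (Fin d → ℤ))) ∩ fiber S T).ncard : ℤ) - (((embed '' (F₂ : Set (Fin d → ℤ))) ∩ fiber S T).ncard : ℤ)) with e | e <;> rw [e] <;> omega

section slice

variable (Q : ℂ →ₗ[ℝ] (Fin d → ℝ)) (P : (Fin d → ℝ) →ₗ[ℝ] ℂ)

/-- the slice of `F` through `x0` -/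
noncomputable def slc (x0 : Fin d → ℤ) (F : Finset (Fin d → ℤ)) : Finset (Fin d → ℤ) := by
  classical exact F.filter (fun x => embed x - embed x0 = Q (P (embed x) - P (embed x0)))

lemma mem_slc (x0 x : Fin d → ℤ) (F : Finset (Fin d → ℤ)) :
    x ∈ slc Q P x0 F ↔ x ∈ F ∧ embed x - embed x0 = Q (P (embed x) - P (embed x0)) := by
  simp [slc]

/-- the coset at height `h` -/
noncomputable def tau (x0 : Fin d → ℤ) (u : ℂ) (h : ℝ) : (Fin d → ℝ) ⧸ (Submodule.span ℝ {Q u}) :=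
  Submodule.Quotient.mk (embed x0 + Q (h * Complex.I * u - P (embed x0)))

variable {Q P}

lemma tau_mem (hPQ : ∀ z, P (Q z) = z) (x0 x : Fin d → ℤ) (u : ℂ) (hu : u ≠ 0) (h : ℝ) :
    (Submodule.Quotient.mk (embed x) : (Fin d → ℝ) ⧸ (Submodule.span ℝ {Q u})) = tau Q P x0 u h ↔
    (embed x - embed x0 = Q (P (embed x) - P (embed x0)) ∧ (P (embed x) / u).im = h) := by
  unfold tau
  rw [Submodule.Quotient.eq, Submodule.mem_span_singleton]
  constructor
  · rintro ⟨t, ht⟩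
    have e1 : embed x - embed x0 = Q (h * Complex.I * u - P (embed x0) + t • u) := by
      rw [map_add, map_smul, ht]; abel
    have e2 : P (embed x) = h * Complex.I * u + t • u := by
      have := congrArg P e1
      rw [map_sub, hPQ] at this
      linear_combination this
    refine ⟨by rw [e1, e2]; congr 1; ring, ?_⟩
    rw [e2, Complex.real_smul, ← add_mul, mul_div_assoc, div_self hu]
    simp
  · rintro ⟨e1, rfl⟩
    refine ⟨(P (embed x) / u).re, ?_⟩
    have : embed x - (embed x0 + Q (((P (embed x) / u).im : ℂ) * Complex.I * u - P (embed x0))) = 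
        Q (P (embed x) - P (embed x0)) - Q (((P (embed x) / u).im : ℂ) * Complex.I * u - P (embed x0)) := by
      rw [← e1]; abel
    rw [this, ← map_sub, ← map_smul]
    congr 1
    have h1 := Complex.re_add_im (P (embed x) / u)
    have h2 : P (embed x) = P (embed x) / u * u := by field_simp
    rw [Complex.real_smul]
    linear_combination u * h1 - h2

lemma slice_card (hPQ : ∀ z, P (Q z) = z) (x0 : Fin d → ℤ) (u : ℂ) (hu : u ≠ 0) (h : ℝ) (F : Finset (Fin d → ℤ)) :
    ((embed '' (F : Set (Fin d → ℤ))) ∩ fiber (Submodule.span ℝ {Q u}) (tau Q P x0 u h)).ncard =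
      ((slc Q P x0 F).filter (fun x => (P (embed x) / u).im = h)).card := by
  classical
  rw [fiber_card _ F _ (fun x => embed x - embed x0 = Q (P (embed x) - P (embed x0)) ∧ (P (embed x) / u).im = h)
    (fun x _ => (tau_mem hPQ x0 x u hu h).symm)]
  congr 1
  ext x
  simp only [Finset.mem_filter, mem_slc, and_assoc]

lemma tau_inj (hPQ : ∀ z, P (Q z) = z) (x0 : Fin d → ℤ) (u : ℂ) (hu : u ≠ 0) : Function.Injective (tau Q P x0 u) := by
  intro h h' he
  unfold tau at he
  rw [Submodule.Quotient.eq, Submodule.mem_span_singleton] at he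
  obtain ⟨t, ht⟩ := he
  have := congrArg P ht
  rw [add_sub_add_left_eq_sub, ← map_sub, hPQ, map_smul, hPQ, Complex.real_smul] at this
  have h3 : (t:ℂ) = (h - h') * Complex.I := by
    apply mul_right_cancel₀ hu; rw [this]; ring
  have := congrArg Complex.im h3
  simp at this
  linarith

lemma slice_bound (hPQ : ∀ z, P (Q z) = z) (x0 : Fin d → ℤ) (u : ℂ) (hu : u ≠ 0) (F₁ F₂ : Finset (Fin d → ℤ)) (H : Finset ℝ) :
    ∑ h ∈ H, ((((slc Q P x0 F₁).filter (fun x => (P (embed x) / u).im = h)).card : ℤ) -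
      (((slc Q P x0 F₂).filter (fun x => (P (embed x) / u).im = h)).card : ℤ)).natAbs ≤ dlt (Submodule.span ℝ {Q u}) F₁ F₂ := by
  classical
  rw [dlt_eq _ F₁ F₂ ((F₁ ∪ F₂).image (fun x => Submodule.Quotient.mk (embed x)) ∪ H.image (tau Q P x0 u))
    (fun x hx => Finset.mem_union_left _ (Finset.mem_image_of_mem _ hx))]
  refine le_trans ?_ (Finset.sum_le_sum_of_subset Finset.subset_union_right)
  rw [Finset.sum_image (fun a _ b _ h => tau_inj hPQ x0 u hu h)]
  apply le_of_eq
  apply Finset.sum_congr rfl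
  intro h _
  rw [slice_card hPQ x0 u hu, slice_card hPQ x0 u hu]

lemma slice_conv (x0 : Fin d → ℤ) (F₁ F₂ : Finset (Fin d → ℤ)) (hF : IsConvexLatticeSet F₂) :
    ∀ x ∈ slc Q P x0 F₁, x ∉ slc Q P x0 F₂ →
      P (embed x) ∉ convexHull ℝ ((fun x => P (embed x)) '' (slc Q P x0 F₂ : Set (Fin d → ℤ))) := by
  intro x hx hx' hcon
  rw [mem_slc] at hx
  apply hx'
  rw [mem_slc]
  refine ⟨?_, hx.2⟩
  let g : ℂ →ᵃ[ℝ] (Fin d → ℝ) := Q.toAffineMap + AffineMap.const ℝ ℂ (embed x0 - Q (P (embed x0)))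
  have hg : ∀ z, g z = Q z + (embed x0 - Q (P (embed x0))) := fun z => by simp [g]
  have hgx : ∀ y, embed y - embed x0 = Q (P (embed y) - P (embed x0)) → g (P (embed y)) = embed y := by
    intro y hy
    rw [hg]
    rw [map_sub, sub_eq_iff_eq_add] at hy
    refine Eq.trans ?_ hy.symm
    abel
  have h1 : g (P (embed x)) ∈ g '' convexHull ℝ ((fun x => P (embed x)) '' (slc Q P x0 F₂ : Set (Fin d → ℤ))) := ⟨_, hcon, rfl⟩
  rw [AffineMap.image_convexHull, hgx x hx.2] at h1
  have h2 : embed x ∈ convexHull ℝ (embed '' (F₂ : Set (Fin d → ℤ))) := by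
    refine convexHull_mono ?_ h1
    rintro _ ⟨_, ⟨y, hy, rfl⟩, rfl⟩
    have hy' := (mem_slc Q P x0 y F₂).1 hy
    exact ⟨y, hy'.1, (hgx y hy'.2).symm⟩
  have h3 : embed x ∈ embed '' (F₂ : Set (Fin d → ℤ)) := by
    rw [hF]; exact ⟨h2, ⟨x, rfl⟩⟩
  obtain ⟨y, hy, he⟩ := h3
  rw [← embed_inj he]; exact hy

theorem core (hPQ : ∀ z, P (Q z) = z) (U : Finset ℂ) (hU0 : ∀ u ∈ U, u ≠ 0) (hU : ∀ u ∈ U, ∀ v ∈ U, u ≠ v → (u / v).im ≠ 0)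
    (uniq : ∀ (A B : Finset (Fin d → ℤ)) (p : (Fin d → ℤ) → ℂ),
      (∀ x ∈ A, x ∉ B → p x ∉ convexHull ℝ (p '' (B : Set (Fin d → ℤ)))) →
      (∀ x ∈ B, x ∉ A → p x ∉ convexHull ℝ (p '' (A : Set (Fin d → ℤ)))) →
      (∀ u ∈ U, ∀ h : ℝ, (A.filter (fun x => (p x / u).im = h)).card = (B.filter (fun x => (p x / u).im = h)).card) → A = B)
    (F₁ F₂ : Finset (Fin d → ℤ)) (h1 : IsConvexLatticeSet F₁) (h2 : IsConvexLatticeSet F₂) (hc : F₁.card = F₂.card)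
    (hne : F₁ ≠ F₂) : 2 * (U.card - 1) ≤ ∑ u ∈ U, dlt (Submodule.span ℝ {Q u}) F₁ F₂ := by
  classical
  set V := U.filter (fun u => dlt (Submodule.span ℝ {Q u}) F₁ F₂ = 0) with hV
  have hVU : V ⊆ U := Finset.filter_subset _ _
  have hVX : ∀ u ∈ V, ∀ x0, ∀ h : ℝ, ((slc Q P x0 F₁).filter (fun x => (P (embed x) / u).im = h)).card = ((slc Q P x0 F₂).filter (fun x => (P (embed x) / u).im = h)).card := by
    intro u hu x0 h
    rw [hV, Finset.mem_filter] at hu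
    rw [← slice_card hPQ x0 u (hU0 u hu.1), ← slice_card hPQ x0 u (hU0 u hu.1)]
    exact dlt_zero _ _ _ hu.2 _
  have hlt : V.card < U.card := by
    apply Finset.card_lt_card
    refine Finset.ssubset_iff_subset_ne.mpr ⟨hVU, fun he => ?_⟩
    have hall : ∀ x0, slc Q P x0 F₁ = slc Q P x0 F₂ := by
      intro x0
      apply uniq _ _ (fun x => P (embed x)) (slice_conv x0 F₁ F₂ h2) (slice_conv x0 F₂ F₁ h1)
      intro u hu h
      exact hVX u (he ▸ hu) x0 h
    apply hne
    ext x
    have : ∀ F : Finset (Fin d → ℤ), x ∈ F ↔ x ∈ slc Q P x F := fun F => by rw [mem_slc]; simp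
    rw [this F₁, this F₂, hall]
  have hbound : ∀ u ∈ U \ V, max 2 (2 * V.card) ≤ dlt (Submodule.span ℝ {Q u}) F₁ F₂ := by
    intro u hu
    rw [Finset.mem_sdiff] at hu
    have hd : dlt (Submodule.span ℝ {Q u}) F₁ F₂ ≠ 0 := fun h => hu.2 (Finset.mem_filter.mpr ⟨hu.1, h⟩)
    refine max_le (dlt_two _ _ _ hc hd) ?_
    rcases Nat.eq_zero_or_pos V.card with h0 | hpos
    · rw [h0]; simp
    have hu0 := hU0 u hu.1
    have : ∃ T, ((embed '' (F₁ : Set (Fin d → ℤ))) ∩ fiber (Submodule.span ℝ {Q u}) T).ncard ≠ ((embed '' (F₂ : Set (Fin d → ℤ))) ∩ fiber (Submodule.span ℝ {Q u}) T).ncard := by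
      by_contra hcon
      push Not at hcon
      apply hd
      unfold dlt
      simp only [hcon, sub_self, Int.natAbs_zero, finsum_zero]
    obtain ⟨T, hT⟩ := this
    obtain ⟨x0, -, rfl⟩ := exists_of_ne _ _ _ _ hT
    have hmk := (tau_mem hPQ x0 x0 u hu0 (P (embed x0) / u).im).2 ⟨by simp, rfl⟩
    rw [hmk, slice_card hPQ x0 u hu0, slice_card hPQ x0 u hu0] at hT
    refine le_trans ?_ (slice_bound hPQ x0 u hu0 F₁ F₂ ((slc Q P x0 F₁ ∪ slc Q P x0 F₂).image (fun x => (P (embed x) / u).im)))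
    refine pte_bound (slc Q P x0 F₁) (slc Q P x0 F₂) (fun x => (P (embed x) / u).im) V.card hpos ?_ ⟨_, hT⟩ _
      (fun x hx => Finset.mem_image_of_mem _ (Finset.mem_union_left _ hx)) (fun x hx => Finset.mem_image_of_mem _ (Finset.mem_union_right _ hx))
    intro j hj
    refine moments _ _ (fun x => P (embed x)) V u hu0 (fun v hv => hVX v hv x0) ?_ ?_ j hj
    · intro v hv; exact hU u hu.1 v (hVU hv) (fun he => hu.2 (he ▸ hv))
    · intro v hv w hw; exact hU v (hVU hv) w (hVU hw)
  have hsum : (U \ V).card * max 2 (2 * V.card) ≤ ∑ u ∈ U, dlt (Submodule.span ℝ {Q u}) F₁ F₂ := by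
    refine le_trans ?_ (Finset.sum_le_sum_of_subset (Finset.sdiff_subset (s := U) (t := V)))
    rw [← smul_eq_mul]
    exact Finset.card_nsmul_le_sum _ _ _ hbound
  refine le_trans ?_ hsum
  rw [Finset.card_sdiff_of_subset hVU]
  obtain ⟨n, hn⟩ : ∃ n, U.card = V.card + 1 + n := ⟨U.card - V.card - 1, by omega⟩
  rw [hn]
  generalize V.card = k
  have e : k + 1 + n - k = n + 1 := by omega
  have e2 : k + 1 + n - 1 = k + n := by omega
  rw [e, e2]
  rcases Nat.eq_zero_or_pos k with rfl | hk
  · have := le_max_left 2 (2 * 0); nlinarith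
  · have := le_max_right 2 (2 * k)
    nlinarith [Nat.mul_le_mul_left n hk]

end slice

end PartCore

section PartFin
lemma xrayDiff_eq (𝒮 : Finset (Submodule ℝ (Fin d → ℝ))) (F₁ F₂ : Finset (Fin d → ℤ)) :
    xrayDiff (↑𝒮 : Set (Submodule ℝ (Fin d → ℝ))) (embed '' ↑F₁) (embed '' ↑F₂) = ∑ S ∈ 𝒮, dlt S F₁ F₂ := by
  unfold xrayDiff dlt
  exact finsum_mem_coe_finset _ _

lemma exists_QP (a b : Fin d → ℝ) (h : ∀ s t : ℝ, s • a + t • b = 0 → s = 0 ∧ t = 0) :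
    ∃ (Q : ℂ →ₗ[ℝ] (Fin d → ℝ)) (P : (Fin d → ℝ) →ₗ[ℝ] ℂ), (∀ z, P (Q z) = z) ∧
      ∀ z : ℂ, Q z = z.re • a + z.im • b := by
  let Q : ℂ →ₗ[ℝ] (Fin d → ℝ) :=
    { toFun := fun z => z.re • a + z.im • b
      map_add' := fun z w => by simp only [Complex.add_re, Complex.add_im, add_smul]; abel
      map_smul' := fun r z => by simp [mul_smul, smul_add] }
  have hQ : ∀ z : ℂ, Q z = z.re • a + z.im • b := fun _ => rfl
  have hk : LinearMap.ker Q = ⊥ := by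
    rw [LinearMap.ker_eq_bot']
    intro z hz
    have := h z.re z.im (by rw [← hQ, hz])
    exact Complex.ext this.1 this.2
  obtain ⟨P, hP⟩ := Q.exists_leftInverse_of_injective hk
  exact ⟨Q, P, fun z => by rw [← LinearMap.comp_apply, hP]; rfl, hQ⟩

lemma span_eq_of_im (Q : ℂ →ₗ[ℝ] (Fin d → ℝ)) (u v : ℂ) (hu : u ≠ 0) (hv : v ≠ 0) (h : (u / v).im = 0) :
    Submodule.span ℝ {Q u} = Submodule.span ℝ {Q v} := by
  have h1 : u = (u / v).re • v := by
    have e := Complex.re_add_im (u / v)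
    rw [h] at e
    simp only [Complex.ofReal_zero, zero_mul, add_zero] at e
    rw [Complex.real_smul, e]; field_simp
  have h2 : (u / v).re ≠ 0 := by
    intro h2; rw [h2, zero_smul] at h1; exact hu h1
  rw [h1, map_smul]
  exact Submodule.span_singleton_smul_eq (IsUnit.mk0 _ h2) _

lemma im_of_brk (u v : ℂ) (h : brk u v = 0) : (u / v).im = 0 := by
  rw [Complex.div_im, ← sub_div]
  unfold brk at h
  rw [show u.im * v.re - u.re * v.im = 0 by linarith, zero_div]

lemma im_of_span (Q : ℂ →ₗ[ℝ] (Fin d → ℝ)) (P : (Fin d → ℝ) →ₗ[ℝ] ℂ) (hPQ : ∀ z, P (Q z) = z)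
    (u v : ℂ) (hv : v ≠ 0) (h : Submodule.span ℝ {Q u} = Submodule.span ℝ {Q v}) : (u / v).im = 0 := by
  have h1 : Q u ∈ Submodule.span ℝ {Q v} := by rw [← h]; exact Submodule.mem_span_singleton_self _
  rw [Submodule.mem_span_singleton] at h1
  obtain ⟨t, ht⟩ := h1
  have := congrArg P ht
  rw [map_smul, hPQ, hPQ] at this
  rw [← this, Complex.real_smul, mul_div_assoc, div_self hv]
  simp

lemma part_one (hd : 2 ≤ d) : ∃ 𝒮 : Finset (Submodule ℝ (Fin d → ℝ)), 𝒮.card = 4 ∧ (∀ S ∈ 𝒮, IsLatticeLine S) ∧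
      ∀ F₁ F₂ : Finset (Fin d → ℤ), IsConvexLatticeSet F₁ → IsConvexLatticeSet F₂ →
        F₁.card = F₂.card → F₁ ≠ F₂ →
        6 ≤ xrayDiff (↑𝒮 : Set (Submodule ℝ (Fin d → ℝ))) (embed '' ↑F₁) (embed '' ↑F₂) := by
  classical
  let i0 : Fin d := ⟨0, by omega⟩
  let i1 : Fin d := ⟨1, by omega⟩
  have hi : i0 ≠ i1 := by simp [i0, i1]
  let w1 : Fin d → ℤ := Pi.single i0 1
  let w2 : Fin d → ℤ := Pi.single i1 1
  obtain ⟨Q, P, hPQ, hQ⟩ := exists_QP (embed w1) (embed w2) (by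
    intro s t h
    have h0 := congrFun h i0
    have h1 := congrFun h i1
    simp [embed, w1, w2, hi, hi.symm] at h0 h1
    exact ⟨h0, h1⟩)
  let c : Fin 4 → ℂ := ![1, Complex.I, ⟨1, 1⟩, ⟨1, 5⟩]
  have hc0 : ∀ a, c a ≠ 0 := by
    intro a h
    have h1 := congrArg Complex.re h
    have h2 := congrArg Complex.im h
    fin_cases a <;> simp [c] at h1 h2
  have hcb : ∀ a b, a ≠ b → (c a / c b).im ≠ 0 := by
    intro a b hab
    fin_cases a <;> fin_cases b <;> first | exact absurd rfl hab | (simp [c, Complex.div_im, Complex.normSq]; try norm_num)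
  have hcinj : Function.Injective c := by
    intro a b h
    by_contra hab
    apply hcb a b hab
    rw [h, div_self (hc0 b)]; simp
  have hsinj : Function.Injective (fun a => Submodule.span ℝ {Q (c a)}) := by
    intro a b h
    by_contra hab
    exact hcb a b hab (im_of_span Q P hPQ _ _ (hc0 b) h)
  refine ⟨Finset.univ.image (fun a => Submodule.span ℝ {Q (c a)}), ?_, ?_, ?_⟩
  · rw [Finset.card_image_of_injective _ hsinj]; rfl
  · intro S hS
    rw [Finset.mem_image] at hS
    obtain ⟨a, -, rfl⟩ := hS
    let n1 : Fin 4 → ℤ := ![1, 0, 1, 1]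
    let n2 : Fin 4 → ℤ := ![0, 1, 1, 5]
    have e1 : ∀ a, (c a).re = n1 a := by
      intro a; fin_cases a <;> simp [c, n1]
    have e2 : ∀ a, (c a).im = n2 a := by
      intro a; fin_cases a <;> simp [c, n2]
    refine ⟨n1 a • w1 + n2 a • w2, ?_, ?_⟩
    · intro h
      apply hc0 a
      have h0 := congrFun h i0
      have h1 := congrFun h i1
      simp [w1, w2, hi, hi.symm] at h0 h1
      apply Complex.ext
      · rw [e1, h0]; simp
      · rw [e2, h1]; simp
    · rw [hQ, e1, e2]
      congr 2
      funext i
      simp [embed]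
  · intro F₁ F₂ h1 h2 hc hne
    rw [xrayDiff_eq, Finset.sum_image (fun a _ b _ h => hsinj h)]
    have := core hPQ (Finset.univ.image c) (by
      intro u hu
      rw [Finset.mem_image] at hu
      obtain ⟨a, -, rfl⟩ := hu
      exact hc0 a) (by
      intro u hu v hv huv
      rw [Finset.mem_image] at hu hv
      obtain ⟨a, -, rfl⟩ := hu
      obtain ⟨b, -, rfl⟩ := hv
      exact hcb a b (fun h => huv (by rw [h]))) (by
      intro A B p hA hB hX
      exact planar4 A B p hA hB (fun a h => hX (c a) (Finset.mem_image_of_mem _ (Finset.mem_univ _)) h)) F₁ F₂ h1 h2 hc hne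
    rw [Finset.sum_image (fun a _ b _ h => hcinj h), Finset.card_image_of_injective _ hcinj] at this
    simpa using this

lemma rational_coord (w1 w2 v : Fin d → ℤ) (s t : ℝ) (h : ∀ s t : ℝ, s • embed w1 + t • embed w2 = 0 → s = 0 ∧ t = 0)
    (hv : embed v = s • embed w1 + t • embed w2) : (∃ q : ℚ, (q : ℝ) = s) ∧ ∃ q : ℚ, (q : ℝ) = t := by
  have hm : ∃ i j, w1 i * w2 j - w1 j * w2 i ≠ 0 := by
    by_contra hcon
    push Not at hcon
    have : ∀ j, w1 j = 0 := by
      intro j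
      have := (h (w2 j) (-(w1 j)) (by
        funext i
        have e : ((w1 i * w2 j - w1 j * w2 i : ℤ) : ℝ) = 0 := by rw [hcon]; simp
        push_cast at e
        simp [embed]; linarith)).2
      exact_mod_cast neg_eq_zero.1 this
    have := (h 1 0 (by funext i; simp [embed, this])).1
    exact one_ne_zero this
  obtain ⟨i, j, hm⟩ := hm
  have hm' : (w1 i : ℝ) * w2 j - w1 j * w2 i ≠ 0 := by exact_mod_cast hm
  have ei := congrFun hv i
  have ej := congrFun hv j
  simp [embed] at ei ej
  refine ⟨⟨(v i * w2 j - v j * w2 i) / (w1 i * w2 j - w1 j * w2 i), ?_⟩, ⟨(w1 i * v j - w1 j * v i) / (w1 i * w2 j - w1 j * w2 i), ?_⟩⟩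
  · push_cast
    rw [div_eq_iff hm', ei, ej]; ring
  · push_cast
    rw [div_eq_iff hm', ei, ej]; ring

lemma part_two (𝒮 : Finset (Submodule ℝ (Fin d → ℝ))) (hL : ∀ S ∈ 𝒮, IsLatticeLine S) (h7 : 7 ≤ 𝒮.card)
      (hW : ∃ W : Submodule ℝ (Fin d → ℝ), Module.finrank ℝ W = 2 ∧ ∀ S ∈ 𝒮, S ≤ W)
      (F₁ F₂ : Finset (Fin d → ℤ)) (h1 : IsConvexLatticeSet F₁) (h2 : IsConvexLatticeSet F₂)
      (hc : F₁.card = F₂.card) (hne : F₁ ≠ F₂) :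
        2 * (𝒮.card - 1) ≤
          xrayDiff (↑𝒮 : Set (Submodule ℝ (Fin d → ℝ))) (embed '' ↑F₁) (embed '' ↑F₂) := by
  classical
  obtain ⟨W, hW2, hSW⟩ := hW
  rw [xrayDiff_eq]
  have hL' : ∀ S : Submodule ℝ (Fin d → ℝ), ∃ v : Fin d → ℤ, S ∈ 𝒮 → v ≠ 0 ∧ S = Submodule.span ℝ {embed v} := by
    intro S
    by_cases hS : S ∈ 𝒮
    · obtain ⟨v, hv, e⟩ := hL S hS
      exact ⟨v, fun _ => ⟨hv, e⟩⟩
    · exact ⟨0, fun h => absurd h hS⟩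
  choose v hv using hL'
  obtain ⟨T, hT, hTc⟩ := Finset.exists_subset_card_eq h7
  let f : Fin 7 ≃ T := (Fintype.equivFinOfCardEq (by simpa using hTc)).symm
  let s : Fin 7 → Submodule ℝ (Fin d → ℝ) := fun j => (f j : Submodule ℝ (Fin d → ℝ))
  have hs : ∀ j, s j ∈ 𝒮 := fun j => hT (f j).2
  have hsi : Function.Injective s := fun a b h => f.injective (Subtype.ext h)
  have hv0 : ∀ S ∈ 𝒮, embed (v S) ≠ 0 := by
    intro S hS h
    apply (hv S hS).1
    apply embed_inj
    rw [h]; funext i; simp [embed]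
  have hli : ∀ x y : ℝ, x • embed (v (s 0)) + y • embed (v (s 1)) = 0 → x = 0 ∧ y = 0 := by
    intro x y hxy
    have key : ∀ j k, s j ≠ s k → ∀ x y : ℝ, x • embed (v (s j)) + y • embed (v (s k)) = 0 → x = 0 := by
      intro j k hjk x y hxy
      by_contra hx
      apply hjk
      have e : embed (v (s j)) = (-y / x) • embed (v (s k)) := by
        have : x • embed (v (s j)) = (-y) • embed (v (s k)) := by
          rw [neg_smul]; exact eq_neg_of_add_eq_zero_left hxy
        rw [div_eq_inv_mul, mul_smul, ← this, smul_smul, inv_mul_cancel₀ hx, one_smul]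
      have hn : -y / x ≠ 0 := by
        intro h; rw [h, zero_smul] at e; exact hv0 _ (hs j) e
      rw [(hv _ (hs j)).2, (hv _ (hs k)).2, e]
      exact Submodule.span_singleton_smul_eq (IsUnit.mk0 _ hn) _
    exact ⟨key 0 1 (hsi.ne (by decide)) x y hxy, key 1 0 (hsi.ne (by decide)) y x (by rw [add_comm]; exact hxy)⟩
  obtain ⟨Q, P, hPQ, hQ⟩ := exists_QP _ _ hli
  have hmem : ∀ S ∈ 𝒮, embed (v S) ∈ W := by
    intro S hS
    apply hSW S hS
    have e := Submodule.mem_span_singleton_self (R := ℝ) (embed (v S))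
    rw [← (hv S hS).2] at e
    exact e
  have hrange : LinearMap.range Q = W := by
    have hle : LinearMap.range Q ≤ W := by
      rintro _ ⟨z, rfl⟩
      rw [hQ]
      exact W.add_mem (W.smul_mem _ (hmem _ (hs 0))) (W.smul_mem _ (hmem _ (hs 1)))
    apply Submodule.eq_of_le_of_finrank_eq hle
    rw [LinearMap.finrank_range_of_inj (Function.LeftInverse.injective hPQ), Complex.finrank_real_complex, hW2]
  let u : Submodule ℝ (Fin d → ℝ) → ℂ := fun S => P (embed (v S))
  have hQu : ∀ S ∈ 𝒮, Q (u S) = embed (v S) := by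
    intro S hS
    have := hmem S hS
    rw [← hrange] at this
    obtain ⟨z, hz⟩ := this
    change Q (P (embed (v S))) = _
    rw [← hz, hPQ]
  have hSu : ∀ S ∈ 𝒮, S = Submodule.span ℝ {Q (u S)} := by
    intro S hS
    rw [hQu S hS]; exact (hv S hS).2
  have hu0 : ∀ S ∈ 𝒮, u S ≠ 0 := by
    intro S hS h
    apply hv0 S hS
    rw [← hQu S hS, h, map_zero]
  have him : ∀ S ∈ 𝒮, ∀ S' ∈ 𝒮, S ≠ S' → (u S / u S').im ≠ 0 := by
    intro S hS S' hS' hne h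
    apply hne
    rw [hSu S hS, hSu S' hS']
    exact span_eq_of_im Q _ _ (hu0 S hS) (hu0 S' hS') h
  have huinj : Set.InjOn u 𝒮 := by
    intro S hS S' hS' h
    rw [hSu S hS, hSu S' hS', h]
  have hu_0 : u (s 0) = 1 := by
    have : Q 1 = embed (v (s 0)) := by rw [hQ]; simp
    change P (embed (v (s 0))) = 1
    rw [← this, hPQ]
  have hu_1 : u (s 1) = Complex.I := by
    have : Q Complex.I = embed (v (s 1)) := by rw [hQ]; simp
    change P (embed (v (s 1))) = Complex.I
    rw [← this, hPQ]
  have hrat : ∀ S, ∃ q : ℚ × ℚ, S ∈ 𝒮 → u S = ⟨q.1, q.2⟩ := by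
    intro S
    by_cases hS : S ∈ 𝒮
    · obtain ⟨⟨q1, e1⟩, ⟨q2, e2⟩⟩ := rational_coord (v (s 0)) (v (s 1)) (v S) (u S).re (u S).im hli (by
        rw [← hQu S hS, hQ])
      exact ⟨(q1, q2), fun _ => Complex.ext e1.symm e2.symm⟩
    · exact ⟨0, fun h => absurd h hS⟩
  choose q hq using hrat
  have hmemU : ∀ j, u (s j) ∈ 𝒮.image u := fun j => Finset.mem_image_of_mem _ (hs j)
  have := core hPQ (𝒮.image u) (by
      intro z hz
      rw [Finset.mem_image] at hz
      obtain ⟨S, hS, rfl⟩ := hz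
      exact hu0 S hS) (by
      intro z hz z' hz' hne
      rw [Finset.mem_image] at hz hz'
      obtain ⟨S, hS, rfl⟩ := hz
      obtain ⟨S', hS', rfl⟩ := hz'
      exact him S hS S' hS' (fun h => hne (by rw [h]))) (by
      intro A B p hA hB hX
      let t : Fin 5 → Fin 7 := ![2, 3, 4, 5, 6]
      have ht0 : ∀ j, t j ≠ 0 := fun j => by revert j; decide
      have ht1 : ∀ j, t j ≠ 1 := fun j => by revert j; decide
      have hti : ∀ j k, j ≠ k → t j ≠ t k := by decide
      refine planar7 A B p hA hB (fun j => u (s (t j))) (fun j => (q (s (t j))).1) (fun j => (q (s (t j))).2)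
        (fun j => hq _ (hs _)) ?_ ?_ ?_ ?_ ?_ ?_
      · intro j h
        apply him _ (hs (t j)) _ (hs 1) (hsi.ne (ht1 j))
        apply im_of_brk
        rw [hu_1, hq _ (hs _)]
        rw [h]; simp [brk]
      · intro j h
        apply him _ (hs (t j)) _ (hs 0) (hsi.ne (ht0 j))
        apply im_of_brk
        rw [hu_0, hq _ (hs _)]
        rw [h]; simp [brk]
      · intro a b hab h
        exact him _ (hs (t a)) _ (hs (t b)) (hsi.ne (hti a b hab)) (im_of_brk _ _ h)
      · intro h
        have := hX _ (hmemU 0) h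
        rwa [hu_0] at this
      · intro h
        have := hX _ (hmemU 1) h
        rwa [hu_1] at this
      · intro a h
        exact hX _ (hmemU (t a)) h) F₁ F₂ h1 h2 hc hne
  rw [Finset.sum_image huinj, Finset.card_image_of_injOn huinj] at this
  refine this.trans (le_of_eq (Finset.sum_congr rfl (fun S hS => ?_)))
  rw [← hSu S hS]

end PartFin

theorem stable_determination_convex_lattice_sets
    (d : ℕ) (hd : 2 ≤ d) :
    (∃ 𝒮 : Finset (Submodule ℝ (Fin d → ℝ)), 𝒮.card = 4 ∧ (∀ S ∈ 𝒮, IsLatticeLine S) ∧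
      ∀ F₁ F₂ : Finset (Fin d → ℤ), IsConvexLatticeSet F₁ → IsConvexLatticeSet F₂ →
        F₁.card = F₂.card → F₁ ≠ F₂ →
        6 ≤ xrayDiff (↑𝒮 : Set (Submodule ℝ (Fin d → ℝ))) (embed '' ↑F₁) (embed '' ↑F₂)) ∧
    (∀ 𝒮 : Finset (Submodule ℝ (Fin d → ℝ)), (∀ S ∈ 𝒮, IsLatticeLine S) → 7 ≤ 𝒮.card →
      (∃ W : Submodule ℝ (Fin d → ℝ), Module.finrank ℝ W = 2 ∧ ∀ S ∈ 𝒮, S ≤ W) →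
      ∀ F₁ F₂ : Finset (Fin d → ℤ), IsConvexLatticeSet F₁ → IsConvexLatticeSet F₂ →
        F₁.card = F₂.card → F₁ ≠ F₂ →
        2 * (𝒮.card - 1) ≤
          xrayDiff (↑𝒮 : Set (Submodule ℝ (Fin d → ℝ))) (embed '' ↑F₁) (embed '' ↑F₂)) := by
  exact ⟨part_one hd, part_two⟩
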